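/- arXiv:2511.08688 — 8 statements merged into one kernel-verified Lean document; each statement's English description precedes it below -/
import Mathlib

section
/- Let k be an infinite field with separable closure k_s, let 1 ≤ n ≤ 8, and let λ = (n₁,…,n₈) be a tuple of nonnegative integers with n = Σ_{i=1}^{8} i·nᵢ. Assume that for each i with nᵢ > 0 the field k admits a separable extension of degree i. Then there exists a finite subset M of the projective plane ℙ²(k_s) with |M| = n such that: (1) M is stable under the coordinatewise action of Gal(k_s/k) on ℙ²(k_s), and for each i ∈ {1,…,8} exactly nᵢ of the Galois orbits contained in M have size i; and (2) M is in general position, i.e. no 3 points of M lie on a common line, no 6 points of M lie on a common conic, and if n = 8 then there is no nonzero homogeneous cubic form over k_s vanishing at all 8 points of M and having a double point at one of them. -/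
/-- The coordinatewise action of `σ ∈ Gal(k_s/k)` on the projective plane `ℙ²(k_s)`:
`σ · [x : y : z] = [σ x : σ y : σ z]`. -/
noncomputable def galAct {k k_s : Type*} [Field k] [Field k_s] [Algebra k k_s]
    (σ : k_s ≃ₐ[k] k_s) (P : Projectivization k_s (Fin 3 → k_s)) :
    Projectivization k_s (Fin 3 → k_s) :=
  Projectivization.mk k_s (fun i => σ (P.rep i)) (by
    intro h
    exact P.rep_nonzero (funext fun i => σ.injective (by
      have hi := congrFun h i
      simpa using hi)))

/-- The orbit of a point of `ℙ²(k_s)` under the coordinatewise Galois action. -/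
def galOrbit (k : Type*) {k_s : Type*} [Field k] [Field k_s] [Algebra k k_s]
    (P : Projectivization k_s (Fin 3 → k_s)) : Set (Projectivization k_s (Fin 3 → k_s)) :=
  {Q | ∃ σ : k_s ≃ₐ[k] k_s, galAct σ P = Q}

namespace GP
open MvPolynomial

variable {K : Type*} [Field K]

lemma eval_smul_hom {F : MvPolynomial (Fin 3) K} {d : ℕ} (hF : F.IsHomogeneous d)
    (a : K) (v : Fin 3 → K) : eval (a • v) F = a ^ d * eval v F := by
  rw [eval_eq', eval_eq', Finset.mul_sum]
  refine Finset.sum_congr rfl fun m hm => ?_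
  have hd := hF (mem_support_iff.mp hm)
  rw [Finsupp.weight_apply, Finsupp.sum_fintype _ _ (by simp)] at hd
  simp only [Fin.sum_univ_three, Pi.one_apply, smul_eq_mul, mul_one] at hd
  simp only [Fin.prod_univ_three, Pi.smul_apply, smul_eq_mul, mul_pow, ← hd, pow_add]
  ring

/-- restriction to the cuspidal cubic -/
noncomputable def res (F : MvPolynomial (Fin 3) K) : Polynomial K :=
  aeval ![Polynomial.X, Polynomial.X ^ 3, 1] F

lemma eval_res (F : MvPolynomial (Fin 3) K) (t : K) :
    (res F).eval t = eval ![t, t ^ 3, 1] F := by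
  unfold res
  induction F using MvPolynomial.induction_on with
  | C a => simp
  | add p q hp hq => simp [hp, hq]
  | mul_X p i hp =>
    simp only [map_mul, Polynomial.eval_mul, hp, aeval_X, eval_X]
    fin_cases i <;> simp

lemma deriv_res (F : MvPolynomial (Fin 3) K) :
    Polynomial.derivative (res F) = res (pderiv 0 F) + 3 * Polynomial.X ^ 2 * res (pderiv 1 F) := by
  unfold res
  induction F using MvPolynomial.induction_on with
  | C a => simp
  | add p q hp hq => simp [hp, hq]; ring
  | mul_X p i hp =>
    simp only [map_mul, Polynomial.derivative_mul, hp, aeval_X, Derivation.leibniz, smul_eq_mul,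
      map_add, pderiv_X]
    have h2 : (Polynomial.C 2 : Polynomial K) = 2 := rfl
    fin_cases i <;> simp [h2] <;> ring

lemma coeff_res (F : MvPolynomial (Fin 3) K) (e : ℕ) :
    (res F).coeff e = ∑ m ∈ F.support, if e = m 0 + 3 * m 1 then coeff m F else 0 := by
  unfold res
  rw [aeval_def, eval₂_eq', Polynomial.finsetSum_coeff]
  refine Finset.sum_congr rfl fun m hm => ?_
  simp only [Fin.prod_univ_three]
  simp [← pow_mul, ← pow_add, Polynomial.coeff_X_pow]

lemma hom_deg {F : MvPolynomial (Fin 3) K} {d : ℕ} (hF : F.IsHomogeneous d) {m : Fin 3 →₀ ℕ}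
    (hm : m ∈ F.support) : m 0 + m 1 + m 2 = d := by
  have hd := hF (mem_support_iff.mp hm)
  rw [Finsupp.weight_apply, Finsupp.sum_fintype _ _ (by simp)] at hd
  simpa only [Fin.sum_univ_three, Pi.one_apply, smul_eq_mul, mul_one] using hd

lemma natDegree_res {F : MvPolynomial (Fin 3) K} {d : ℕ} (hF : F.IsHomogeneous d) :
    (res F).natDegree ≤ 3 * d := by
  rw [Polynomial.natDegree_le_iff_coeff_eq_zero]
  intro e he
  rw [coeff_res]
  refine Finset.sum_eq_zero fun m hm => ?_
  have := hom_deg hF hm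
  rw [if_neg (by omega)]

lemma coeff_pred_res {F : MvPolynomial (Fin 3) K} {d : ℕ} (hd : 1 ≤ d) (hF : F.IsHomogeneous d) :
    (res F).coeff (3 * d - 1) = 0 := by
  rw [coeff_res]
  refine Finset.sum_eq_zero fun m hm => ?_
  have := hom_deg hF hm
  rw [if_neg (by omega)]

lemma eq_zero_of_res {F : MvPolynomial (Fin 3) K} {d : ℕ} (hd : d ≤ 2) (hF : F.IsHomogeneous d)
    (h : res F = 0) : F = 0 := by
  by_contra hne
  obtain ⟨m, hm⟩ := Finset.nonempty_of_ne_empty (mt support_eq_empty.mp hne)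
  have h1 := coeff_res F (m 0 + 3 * m 1)
  rw [h, Polynomial.coeff_zero, Finset.sum_eq_single m, if_pos rfl] at h1
  · exact mem_support_iff.mp hm h1.symm
  · intro m' hm' hn
    rw [if_neg]
    intro he
    apply hn
    have := hom_deg hF hm
    have := hom_deg hF hm'
    ext i
    fin_cases i <;> simp <;> omega
  · exact fun h => absurd hm h

lemma eq_zero_of_res3 {F : MvPolynomial (Fin 3) K} (hF : F.IsHomogeneous 3)
    (h : res F = 0) (t : K) (ht : eval ![t, t ^ 3, 1] (pderiv 1 F) = 0) : F = 0 := by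
  have key : ∀ m ∈ F.support, m 0 + 3 * m 1 = 3 := by
    intro m hm
    by_contra hc
    have h1 := coeff_res F (m 0 + 3 * m 1)
    rw [h, Polynomial.coeff_zero, Finset.sum_eq_single m, if_pos rfl] at h1
    · exact mem_support_iff.mp hm h1.symm
    · intro m' hm' hn
      rw [if_neg]
      intro he
      apply hn
      have := hom_deg hF hm
      have := hom_deg hF hm'
      ext i
      fin_cases i <;> simp <;> omega
    · exact fun h => absurd hm h
  set a := Finsupp.single (0 : Fin 3) 3 with ha
  set b := Finsupp.single (1 : Fin 3) 1 + Finsupp.single (2 : Fin 3) 2 with hb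
  have hab : a ≠ b := by
    intro hh
    have := DFunLike.congr_fun hh 0
    simp [a, b] at this
  have hsub : F.support ⊆ {a, b} := by
    intro m hm
    have h1 := hom_deg hF hm
    have h2 := key m hm
    rw [Finset.mem_insert, Finset.mem_singleton]
    rcases Nat.eq_zero_or_pos (m 1) with h3 | h3
    · left
      ext i
      fin_cases i <;> simp [a] <;> omega
    · right
      ext i
      fin_cases i <;> simp [b] <;> omega
  have hform : F = monomial a (coeff a F) + monomial b (coeff b F) := by
    conv_lhs => rw [F.as_sum]
    rw [Finset.sum_subset hsub, Finset.sum_pair hab]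
    intro x _ hx
    rw [notMem_support_iff.mp hx, map_zero]
  have hB : coeff b F = 0 := by
    rw [hform] at ht
    simpa [pderiv_monomial, eval_monomial, a, b, Finsupp.prod_fintype, Fin.prod_univ_three] using ht
  rw [hB, map_zero, add_zero] at hform
  have hA : coeff a F = 0 := by
    have := eval_res F 1
    rw [h, hform] at this
    simpa [eval_monomial, a] using this.symm
  rw [hform, hA, map_zero]

lemma poly_zero (f : Polynomial K) (s : Multiset K) (N : ℕ) (hN : 1 ≤ N)
    (hs : Multiset.card s = N) (hsum : s.sum ≠ 0) (hdeg : f.natDegree ≤ N)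
    (hc : f.coeff (N - 1) = 0) (hroots : f ≠ 0 → s ≤ f.roots) : f = 0 := by
  by_contra hf
  have hdvd := (Multiset.prod_dvd_prod_of_le <| Multiset.map_le_map (f := fun a => Polynomial.X - Polynomial.C a) (hroots hf)).trans
    f.prod_multiset_X_sub_C_dvd
  obtain ⟨q, hq⟩ := hdvd
  set p := (s.map fun a => Polynomial.X - Polynomial.C a).prod with hp
  have hpm : p.Monic := Polynomial.monic_multiset_prod_of_monic _ _ fun a _ => Polynomial.monic_X_sub_C a
  have hpd : p.natDegree = N := by rw [hp, Polynomial.natDegree_multiset_prod_X_sub_C_eq_card, hs]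
  have hq0 : q ≠ 0 := by rintro rfl; simp at hq; exact hf hq
  have hqd : q.natDegree = 0 := by
    have := hpm.natDegree_mul' hq0
    rw [← hq] at this; omega
  rw [Polynomial.eq_C_of_natDegree_eq_zero hqd] at hq
  rw [hq, Polynomial.coeff_mul_C, ← hs, hp,
    Polynomial.multiset_prod_X_sub_C_coeff_card_pred _ (by omega)] at hc
  rcases mul_eq_zero.mp hc with h | h
  · exact hsum (neg_eq_zero.mp h)
  · rw [h] at hq; simp at hq; exact hf hq

lemma low_deg {F : MvPolynomial (Fin 3) K} {d : ℕ} (hd1 : 1 ≤ d) (hd : d ≤ 2)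
    (hF : F.IsHomogeneous d) (s : Finset K) (hs : s.card = 3 * d) (hsum : ∑ x ∈ s, x ≠ 0)
    (h : ∀ x ∈ s, eval ![x, x ^ 3, 1] F = 0) : F = 0 := by
  refine eq_zero_of_res hd hF ?_
  refine poly_zero _ s.val (3 * d) (by omega) hs (by simpa [Finset.sum_val] using hsum)
    (natDegree_res hF) (coeff_pred_res hd1 hF) fun hne => ?_
  rw [Multiset.le_iff_subset s.nodup]
  intro x hx
  rw [Polynomial.mem_roots hne, Polynomial.IsRoot, eval_res]
  exact h x hx

lemma deg3 {F : MvPolynomial (Fin 3) K}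
    (hF : F.IsHomogeneous 3) (s : Finset K) (hs : s.card = 8) (y : K) (hy : y ∈ s)
    (hsum : y + ∑ x ∈ s, x ≠ 0)
    (h : ∀ x ∈ s, eval ![x, x ^ 3, 1] F = 0)
    (h0 : eval ![y, y ^ 3, 1] (pderiv 0 F) = 0)
    (h1 : eval ![y, y ^ 3, 1] (pderiv 1 F) = 0) : F = 0 := by
  classical
  refine eq_zero_of_res3 hF ?_ y h1
  refine poly_zero _ (y ::ₘ s.val) 9 (by omega) (by simp [hs]) (by simpa [Finset.sum_val] using hsum)
    (natDegree_res hF) (coeff_pred_res (by omega) hF) fun hne => ?_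
  rw [Multiset.le_iff_count]
  intro x
  have hroot : ∀ x ∈ s, (res F).IsRoot x := fun x hx => by
    rw [Polynomial.IsRoot, eval_res]; exact h x hx
  rw [Polynomial.count_roots, Multiset.count_cons, Multiset.count_eq_of_nodup s.nodup]
  split_ifs with h2 h3 h3
  · subst h3
    refine (Polynomial.one_lt_rootMultiplicity_iff_isRoot hne).mpr ⟨hroot x hy, ?_⟩
    rw [deriv_res, Polynomial.IsRoot]
    simp [eval_res, h0, h1]
  · exact (Polynomial.rootMultiplicity_pos hne).mpr (hroot x h2)
  · subst h3; exact absurd hy h2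
  · simp

end GP

namespace GP

variable {k k_s : Type*} [Field k] [Field k_s] [Algebra k k_s]

lemma exists_generic [Infinite k] {J : Type*} [Fintype J] [DecidableEq J]
    (L : J → IntermediateField k k_s) [∀ j, FiniteDimensional k (L j)]
    (C : Set ((Σ j, (L j →ₐ[k] k_s)) → k_s)) (hC : C.Finite) :
    ∃ v : (j : J) → L j, ∀ c ∈ C, c ≠ 0 → ∑ a, c a * a.2 (v a.1) ≠ 0 := by
  have : Finite {c // c ∈ C ∧ c ≠ 0} := Set.Finite.subset hC (fun c hc => hc.1)
  let f : ((Σ j, (L j →ₐ[k] k_s)) → k_s) → ((j : J) → L j) →ₗ[k] k_s := fun c =>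
    ∑ a, c a • (a.2.toLinearMap ∘ₗ LinearMap.proj a.1)
  have hf : ∀ c v, f c v = ∑ a, c a * a.2 (v a.1) := by
    intro c v; simp [f]
  obtain ⟨v, hv⟩ := Submodule.exists_forall_notMem_of_forall_ne_top
    (K := k) (fun c : {c // c ∈ C ∧ c ≠ 0} => LinearMap.ker (f c.1)) (by
      rintro ⟨c, hcC, hc⟩ htop
      apply hc
      have h0 : ∀ v, f c v = 0 := fun v => by
        have : v ∈ LinearMap.ker (f c) := htop ▸ Submodule.mem_top
        exact this
      funext ⟨j, φ⟩
      have hli := linearIndependent_toLinearMap k (L j) k_s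
      rw [Fintype.linearIndependent_iff] at hli
      refine hli (fun φ => c ⟨j, φ⟩) ?_ φ
      ext x
      have := h0 (Pi.single j x)
      rw [hf, Fintype.sum_sigma, Finset.sum_eq_single j] at this
      · simpa using this
      · intro j' _ hj
        simp [Pi.single_eq_of_ne hj]
      · simp)
  exact ⟨v, fun c hc hc0 h => hv ⟨c, hc, hc0⟩ (by rw [LinearMap.mem_ker, hf]; exact h)⟩

lemma exists_t [Infinite k] {J : Type*} [Fintype J] 
    (L : J → IntermediateField k k_s) [∀ j, FiniteDimensional k (L j)] :
    ∃ v : (j : J) → L j,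
      (Function.Injective fun a : (Σ j, (L j →ₐ[k] k_s)) => a.2 (v a.1)) ∧
      (∀ T : Finset (Σ j, (L j →ₐ[k] k_s)), T.Nonempty → ∑ a ∈ T, a.2 (v a.1) ≠ 0) ∧
      (2 ≤ Fintype.card (Σ j, (L j →ₐ[k] k_s)) → ∀ b : (Σ j, (L j →ₐ[k] k_s)),
        b.2 (v b.1) + ∑ a : (Σ j, (L j →ₐ[k] k_s)), a.2 (v a.1) ≠ 0) := by
  classical
  let f1 : (Σ j, (L j →ₐ[k] k_s)) × (Σ j, (L j →ₐ[k] k_s)) → (Σ j, (L j →ₐ[k] k_s)) → k_s :=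
    fun p => Pi.single p.1 1 - Pi.single p.2 1
  let f2 : Finset (Σ j, (L j →ₐ[k] k_s)) → (Σ j, (L j →ₐ[k] k_s)) → k_s :=
    fun T a => if a ∈ T then 1 else 0
  let f3 : (Σ j, (L j →ₐ[k] k_s)) → (Σ j, (L j →ₐ[k] k_s)) → k_s :=
    fun b => Pi.single b 1 + 1
  obtain ⟨v, hv⟩ := exists_generic L (Set.range f1 ∪ Set.range f2 ∪ Set.range f3)
    (((Set.finite_range _).union (Set.finite_range _)).union (Set.finite_range _))
  refine ⟨v, ?_, ?_, ?_⟩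
  · intro a b hab
    by_contra hne
    refine hv (f1 (a, b)) (Or.inl (Or.inl ⟨_, rfl⟩)) ?_ ?_
    · intro h
      have := congrFun h a
      simp [f1, Pi.single_eq_of_ne hne] at this
    · simp only at hab
      simp [f1, sub_mul, Finset.sum_sub_distrib, Pi.single_apply, hab]
  · rintro T ⟨a, ha⟩
    have := hv (f2 T) (Or.inl (Or.inr ⟨_, rfl⟩)) (by
      intro h
      have := congrFun h a
      simp [f2, ha] at this)
    simpa [f2] using this
  · intro hc b
    have := hv (f3 b) (Or.inr ⟨_, rfl⟩) (by
      intro h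
      have : Nontrivial (Σ j, (L j →ₐ[k] k_s)) := Fintype.one_lt_card_iff_nontrivial.mp hc
      obtain ⟨a, ha⟩ := exists_ne b
      have := congrFun h a
      simp [f3, Pi.single_eq_of_ne ha] at this)
    simpa [f3, add_mul, Finset.sum_add_distrib, Pi.single_apply] using this

lemma card_emb [IsSepClosure k k_s] (L : IntermediateField k k_s) [FiniteDimensional k L] :
    Nat.card (L →ₐ[k] k_s) = Module.finrank k L := by
  have := IsSepClosure.sep_closed k (K := k_s)
  exact AlgHom.natCard_of_splits k L k_s fun x =>
    IsSepClosed.splits_codomain _ (Algebra.IsSeparable.isSeparable k x)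

lemma trans_emb [IsSepClosure k k_s] (L : IntermediateField k k_s) (φ ψ : L →ₐ[k] k_s) :
    ∃ σ : k_s ≃ₐ[k] k_s, ∀ x, σ (φ x) = ψ x := by
  have := IsSepClosure.sep_closed k (K := k_s)
  have key : ∀ φ : L →ₐ[k] k_s, ∃ σ : k_s ≃ₐ[k] k_s, ∀ x : L, σ x = φ x := by
    intro φ
    obtain ⟨g, hg⟩ := IntermediateField.exists_algHom_of_splits (K := k_s) (fun x : k_s =>
      ⟨Algebra.IsIntegral.isIntegral x,
      IsSepClosed.splits_codomain _ (Algebra.IsSeparable.isSeparable k x)⟩) φ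
    refine ⟨(Algebra.IsAlgebraic.algEquivEquivAlgHom k k_s).symm g, fun x => ?_⟩
    rw [← hg]; rfl
  obtain ⟨a, ha⟩ := key φ
  obtain ⟨b, hb⟩ := key ψ
  refine ⟨a.symm.trans b, fun x => ?_⟩
  rw [← ha, ← hb]; simp

/-- point on the cuspidal cubic -/
noncomputable def pt (t : k_s) : Projectivization k_s (Fin 3 → k_s) :=
  Projectivization.mk k_s ![t, t ^ 3, 1] (fun h => by simpa using congrFun h 2)

lemma pt_inj : Function.Injective (pt : k_s → _) := by
  intro a b h
  obtain ⟨c, hc⟩ := (Projectivization.mk_eq_mk_iff' _ _ _ _ _).mp h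
  have h2 := congrFun hc 2
  have h0 := congrFun hc 0
  simp at h2 h0
  rw [h2] at h0; simpa using h0.symm

lemma pt_rep (t : k_s) : ∃ c : k_s, c ≠ 0 ∧ (pt t).rep = c • ![t, t ^ 3, 1] := by
  obtain ⟨a, ha⟩ := Projectivization.exists_smul_eq_mk_rep k_s ![t, t ^ 3, 1]
    (fun h => by simpa using congrFun h 2)
  exact ⟨a, a.ne_zero, ha.symm⟩

lemma galAct_pt (σ : k_s ≃ₐ[k] k_s) (t : k_s) : galAct σ (pt t) = pt (σ t) := by
  obtain ⟨c, hc, h⟩ := pt_rep t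
  unfold galAct
  simp only [h]
  unfold pt
  rw [Projectivization.mk_eq_mk_iff']
  refine ⟨σ c, ?_⟩
  ext i
  fin_cases i <;> simp

lemma eval_pt {F : MvPolynomial (Fin 3) k_s} {d : ℕ} (hF : F.IsHomogeneous d) (t : k_s)
    (h : MvPolynomial.eval (pt t).rep F = 0) : MvPolynomial.eval ![t, t ^ 3, 1] F = 0 := by
  obtain ⟨c, hc, hr⟩ := pt_rep t
  rw [hr, eval_smul_hom hF] at h
  exact (mul_eq_zero.mp h).resolve_left (pow_ne_zero _ hc)

end GP

set_option maxHeartbeats 1000000 in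
/-- **General position in the plane.** Let `k` be an infinite field with separable closure
`k_s`, `1 ≤ n ≤ 8`, and `lam 1, …, lam 8` nonnegative integers with `n = ∑ i, i * lam i`.
If `k` admits a separable extension of degree `i` (equivalently, a degree-`i` subextension of
`k_s/k`) whenever `lam i > 0`, then there is a Galois-stable set `M ⊆ ℙ²(k_s)` of `n` points,
with exactly `lam i` Galois orbits of size `i` for each `i`, in general position: no 3 points
on a line, no 6 on a conic, and (if `n = 8`) no nonzero cubic form through all 8 points with a
double point at one of them. -/
theorem stmt_0 {k k_s : Type*} [Field k] [Infinite k] [Field k_s] [Algebra k k_s]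
    [IsSepClosure k k_s] (n : ℕ) (hn1 : 1 ≤ n) (hn8 : n ≤ 8) (lam : ℕ → ℕ)
    (hsum : n = ∑ i ∈ Finset.Icc 1 8, i * lam i)
    (hext : ∀ i ∈ Finset.Icc 1 8, 0 < lam i →
      ∃ L : IntermediateField k k_s, Module.finrank k ↥L = i) :
    ∃ M : Finset (Projectivization k_s (Fin 3 → k_s)),
      M.card = n ∧
      (∀ σ : k_s ≃ₐ[k] k_s, ∀ P ∈ M, galAct σ P ∈ M) ∧
      (∀ i ∈ Finset.Icc 1 8,
        Set.ncard {O : Set (Projectivization k_s (Fin 3 → k_s)) |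
          (∃ P ∈ M, O = galOrbit k P) ∧ O.ncard = i} = lam i) ∧
      (∀ S : Finset (Projectivization k_s (Fin 3 → k_s)), S ⊆ M → S.card = 3 →
        ¬∃ F : MvPolynomial (Fin 3) k_s, F ≠ 0 ∧ F.IsHomogeneous 1 ∧
          ∀ P ∈ S, MvPolynomial.eval P.rep F = 0) ∧
      (∀ S : Finset (Projectivization k_s (Fin 3 → k_s)), S ⊆ M → S.card = 6 →
        ¬∃ F : MvPolynomial (Fin 3) k_s, F ≠ 0 ∧ F.IsHomogeneous 2 ∧
          ∀ P ∈ S, MvPolynomial.eval P.rep F = 0) ∧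
      (n = 8 → ¬∃ F : MvPolynomial (Fin 3) k_s, F ≠ 0 ∧ F.IsHomogeneous 3 ∧
        (∀ P ∈ M, MvPolynomial.eval P.rep F = 0) ∧
        ∃ P ∈ M, ∀ j : Fin 3, MvPolynomial.eval P.rep (MvPolynomial.pderiv j F) = 0) := by
  classical
  let J := Σ i : Finset.Icc 1 8, Fin (lam i)
  have hL : ∀ j : J, ∃ L : IntermediateField k k_s, Module.finrank k ↥L = j.1 := fun j =>
    hext j.1 j.1.2 (Fin.pos j.2)
  choose L hL using hL
  have hfd : ∀ j, FiniteDimensional k (L j) := fun j =>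
    FiniteDimensional.of_finrank_pos (by
      rw [hL]; exact (Finset.mem_Icc.mp j.1.2).1)
  obtain ⟨v, hinj, hT, hS⟩ := GP.exists_t L
  have hcardJ : ∀ j : J, Fintype.card (L j →ₐ[k] k_s) = j.1 := fun j => by
    rw [Fintype.card_eq_nat_card, GP.card_emb, hL]
  have hcard : Fintype.card (Σ j, (L j →ₐ[k] k_s)) = n := by
    rw [Fintype.card_sigma, hsum]
    simp only [hcardJ]
    rw [Fintype.sum_sigma, ← Finset.sum_coe_sort (Finset.Icc 1 8)]
    refine Finset.sum_congr rfl fun i _ => ?_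
    simp [mul_comm]
  set t : (Σ j, (L j →ₐ[k] k_s)) → k_s := fun a => a.2 (v a.1) with ht
  have hpinj : Function.Injective (fun a => GP.pt (t a)) := GP.pt_inj.comp hinj
  have horb : ∀ a, galOrbit k (GP.pt (t a)) =
      (fun φ : (L a.1 →ₐ[k] k_s) => GP.pt (t ⟨a.1, φ⟩)) '' Set.univ := by
    rintro ⟨j, φ⟩
    ext Q
    simp only [galOrbit, GP.galAct_pt, Set.mem_ofPred_eq, Set.image_univ, Set.mem_range]
    constructor
    · rintro ⟨σ, rfl⟩
      exact ⟨σ.toAlgHom.comp φ, rfl⟩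
    · rintro ⟨ψ, rfl⟩
      obtain ⟨σ, hσ⟩ := GP.trans_emb (L j) φ ψ
      exact ⟨σ, by rw [ht]; simp only [hσ]⟩
  have hsubset : ∀ S : Finset (Projectivization k_s (Fin 3 → k_s)),
      S ⊆ Finset.univ.image (fun a => GP.pt (t a)) →
      ∃ T : Finset (Σ j, (L j →ₐ[k] k_s)), T.card = S.card ∧ S = T.image (fun a => GP.pt (t a)) := by
    intro S hS
    obtain ⟨T, -, rfl⟩ := Finset.subset_image_iff.mp hS
    exact ⟨T, (Finset.card_image_of_injective _ hpinj).symm, rfl⟩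
  have hlow : ∀ d, 1 ≤ d → d ≤ 2 → ∀ S : Finset (Projectivization k_s (Fin 3 → k_s)),
      S ⊆ Finset.univ.image (fun a => GP.pt (t a)) → S.card = 3 * d →
        ¬∃ F : MvPolynomial (Fin 3) k_s, F ≠ 0 ∧ F.IsHomogeneous d ∧
          ∀ P ∈ S, MvPolynomial.eval P.rep F = 0 := by
    rintro d hd1 hd2 S hSM hSc ⟨F, hF0, hF, hv⟩
    obtain ⟨T, hTc, rfl⟩ := hsubset S hSM
    refine hF0 (GP.low_deg hd1 hd2 hF (T.image t) ?_ ?_ ?_)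
    · rw [Finset.card_image_of_injective _ hinj, hTc, hSc]
    · rw [Finset.sum_image (fun a _ b _ h => hinj h)]
      exact hT T (Finset.card_pos.mp (by omega))
    · intro x hx
      obtain ⟨a, ha, rfl⟩ := Finset.mem_image.mp hx
      exact GP.eval_pt hF _ (hv _ (Finset.mem_image_of_mem _ ha))
  refine ⟨Finset.univ.image (fun a => GP.pt (t a)), ?_, ?_, ?_, hlow 1 le_rfl (by omega),
    hlow 2 (by omega) le_rfl, ?_⟩
  · rw [Finset.card_image_of_injective _ hpinj, Finset.card_univ, hcard]
  · intro σ P hP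
    obtain ⟨⟨j, φ⟩, -, rfl⟩ := Finset.mem_image.mp hP
    rw [GP.galAct_pt]
    exact Finset.mem_image.mpr ⟨⟨j, σ.toAlgHom.comp φ⟩, Finset.mem_univ _, rfl⟩
  · intro i hi
    let O : J → Set (Projectivization k_s (Fin 3 → k_s)) := fun j =>
      (fun φ : (L j →ₐ[k] k_s) => GP.pt (t ⟨j, φ⟩)) '' Set.univ
    have horb' : ∀ j φ, galOrbit k (GP.pt (t ⟨j, φ⟩)) = O j := fun j φ => horb ⟨j, φ⟩
    have hOc : ∀ j, (O j).ncard = j.1 := by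
      intro j
      rw [Set.ncard_image_of_injective, Set.ncard_univ, ← Fintype.card_eq_nat_card, hcardJ]
      intro φ ψ h
      have := hpinj h
      simpa using this
    have hne : ∀ j : J, Nonempty (L j →ₐ[k] k_s) := fun j => ⟨(L j).val⟩
    have hOi : Function.Injective O := by
      intro j j' h
      obtain ⟨φ⟩ := hne j
      have h1 : GP.pt (t ⟨j, φ⟩) ∈ O j := ⟨φ, trivial, rfl⟩
      rw [h] at h1
      obtain ⟨ψ, -, h2⟩ := h1
      exact (congrArg Sigma.fst (hpinj h2)).symm
    have hset : {O : Set (Projectivization k_s (Fin 3 → k_s)) |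
          (∃ P ∈ Finset.univ.image (fun a => GP.pt (t a)), O = galOrbit k P) ∧ O.ncard = i} =
        (fun m : Fin (lam i) => O ⟨⟨i, hi⟩, m⟩) '' Set.univ := by
      ext A
      simp only [Set.mem_ofPred_eq, Set.image_univ, Set.mem_range]
      constructor
      · rintro ⟨⟨P, hP, rfl⟩, hA⟩
        obtain ⟨⟨⟨⟨i', hi'⟩, m⟩, φ⟩, -, rfl⟩ := Finset.mem_image.mp hP
        rw [horb] at hA ⊢
        have := hOc ⟨⟨i', hi'⟩, m⟩
        have hii : i' = i := this.symm.trans hA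
        subst hii
        exact ⟨m, rfl⟩
      · rintro ⟨m, rfl⟩
        refine ⟨?_, hOc _⟩
        obtain ⟨φ⟩ := hne ⟨⟨i, hi⟩, m⟩
        refine ⟨GP.pt (t ⟨⟨⟨i, hi⟩, m⟩, φ⟩), Finset.mem_image.mpr ⟨_, Finset.mem_univ _, rfl⟩, ?_⟩
        rw [horb']
    rw [hset, Set.ncard_image_of_injective, Set.ncard_univ, Nat.card_eq_fintype_card,
      Fintype.card_fin]
    intro m m' h
    exact eq_of_heq (Sigma.mk.inj (hOi h)).2
  · rintro hn ⟨F, hF0, hF, hv, P, hP, hd⟩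
    obtain ⟨b, -, rfl⟩ := Finset.mem_image.mp hP
    refine hF0 (GP.deg3 hF (Finset.univ.image t) ?_ (t b)
      (Finset.mem_image_of_mem _ (Finset.mem_univ _)) ?_ ?_ ?_ ?_)
    · rw [Finset.card_image_of_injective _ hinj, Finset.card_univ, hcard, hn]
    · rw [Finset.sum_image (fun a _ b _ h => hinj h)]
      exact hS (by omega) b
    · intro x hx
      obtain ⟨a, ha, rfl⟩ := Finset.mem_image.mp hx
      exact GP.eval_pt hF _ (hv _ (Finset.mem_image_of_mem _ ha))
    · exact GP.eval_pt hF.pderiv _ (hd 0)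
    · exact GP.eval_pt hF.pderiv _ (hd 1)
end

section
/- Let k be an infinite field of characteristic 2 with separable closure k_s. Let V = {v ∈ 𝔽₂⁵ : v₁ + ⋯ + v₅ = 0}, let G₅ ≤ S₅ be either the cyclic subgroup of order 5 generated by the 5-cycle (1 2 3 4 5) or the alternating group A₅, let G₅ act on V by permuting coordinates, and set G = V ⋊ G₅. Suppose there exists a Galois field extension L/k with Gal(L/k) ≅ G. Then there exist a monic separable quintic polynomial f ∈ k[x] with five distinct roots α₁,…,α₅ ∈ k_s, and elements x₁, x₂, x₃, x₄ ∈ k_s with xᵢ² + xᵢ + αᵢ = 0 for i = 1,…,4, such that the subfield L′ = k(x₁, x₂, x₃, x₄) of k_s is a Galois extension of k with Gal(L′/k) ≅ G. -/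
universe u

/-- The even-sum subgroup `V = {v ∈ 𝔽₂⁵ : v₁ + ⋯ + v₅ = 0} ≅ C₂⁴` of `𝔽₂⁵`. -/
def evenSum : AddSubgroup (Fin 5 → ZMod 2) where
  carrier := {v | ∑ i, v i = 0}
  zero_mem' := by simp
  add_mem' := by
    intro a b ha hb
    simp only [Set.mem_setOf_eq] at ha hb ⊢
    simp [Finset.sum_add_distrib, ha, hb]
  neg_mem' := by
    intro a ha
    simp only [Set.mem_setOf_eq] at ha ⊢
    simp [Finset.sum_neg_distrib, ha]

/-- The coordinate-permutation action of `σ ∈ S₅` on the even-sum subgroup of `𝔽₂⁵`. -/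
def permAddAut (σ : Equiv.Perm (Fin 5)) : ↥evenSum ≃+ ↥evenSum where
  toFun v := ⟨fun i => (v : Fin 5 → ZMod 2) (σ.symm i), by
    show ∑ i, (v : Fin 5 → ZMod 2) (σ.symm i) = 0
    rw [Equiv.sum_comp σ.symm (v : Fin 5 → ZMod 2)]
    exact v.2⟩
  invFun v := ⟨fun i => (v : Fin 5 → ZMod 2) (σ i), by
    show ∑ i, (v : Fin 5 → ZMod 2) (σ i) = 0
    rw [Equiv.sum_comp σ (v : Fin 5 → ZMod 2)]
    exact v.2⟩
  left_inv v := Subtype.ext (funext fun i => by simp)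
  right_inv v := Subtype.ext (funext fun i => by simp)
  map_add' u v := Subtype.ext (funext fun i => rfl)

/-- The permutation action of `S₅` on (the multiplicative version of) the even-sum subgroup
`V ≅ C₂⁴` of `𝔽₂⁵`, as a homomorphism into the automorphism group. -/
def permPhi : Equiv.Perm (Fin 5) →* MulAut (Multiplicative ↥evenSum) where
  toFun σ := AddEquiv.toMultiplicative (permAddAut σ)
  map_one' := by apply MulEquiv.ext; intro v; rfl
  map_mul' σ τ := by apply MulEquiv.ext; intro v; rfl

/-- For a subgroup `G₅ ≤ S₅`, the semidirect product `G = V ⋊ G₅` of the even-sum subgroup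
`V ≅ C₂⁴` of `𝔽₂⁵` by `G₅`, acting by permuting coordinates. -/
abbrev VSemidirect (H5 : Subgroup (Equiv.Perm (Fin 5))) : Type :=
  Multiplicative ↥evenSum ⋊[permPhi.comp H5.subtype] ↥H5

theorem stmt_2_finite (k L : Type u) [Field k] [Field L] [Algebra k L] [IsGalois k L]
    [Finite (L ≃ₐ[k] L)] : FiniteDimensional k L := by
  have h : IntermediateField.fixedField (⊤ : Subgroup (L ≃ₐ[k] L)) = ⊥ := by
    rw [← IntermediateField.fixingSubgroup_bot, InfiniteGalois.fixedField_fixingSubgroup]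
  have h2 : FiniteDimensional (IntermediateField.fixedField (⊤ : Subgroup (L ≃ₐ[k] L))) L :=
    inferInstanceAs (FiniteDimensional
      (FixedPoints.subfield (⊤ : Subgroup (L ≃ₐ[k] L)) L) L)
  rw [h] at h2
  haveI : Module.Finite k (⊥ : IntermediateField k L) := inferInstance
  exact Module.Finite.trans (⊥ : IntermediateField k L) L

theorem stmt_2_poly (k : Type u) {L : Type u} [Field k] [Field L] [Algebra k L] [IsGalois k L]
    [FiniteDimensional k L] (α : Fin 5 → L)
    (h : ∀ g : L ≃ₐ[k] L, ∃ σ : Equiv.Perm (Fin 5), ∀ i, g (α i) = α (σ i)) :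
    ∃ f : Polynomial k, f.map (algebraMap k L) = ∏ i, (Polynomial.X - Polynomial.C (α i)) ∧
      f.natDegree = 5 ∧ f.Monic := by
  set p : Polynomial L := ∏ i, (Polynomial.X - Polynomial.C (α i)) with hp
  have hm : p.Monic := Polynomial.monic_prod_X_sub_C _ _
  have hd : p.natDegree = 5 := by
    rw [hp, Polynomial.natDegree_finset_prod_X_sub_C_eq_card]; simp
  have hl : p ∈ Polynomial.lifts (algebraMap k L) := by
    rw [Polynomial.lifts_iff_coeff_lifts]
    intro n
    refine (IsGalois.mem_range_algebraMap_iff_fixed (F := k) (E := L) _).2 ?_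
    intro g
    obtain ⟨σ, hσ⟩ := h g
    have : p.map (g : L →+* L) = p := by
      rw [hp, Polynomial.map_prod]
      simp only [Polynomial.map_sub, Polynomial.map_X, Polynomial.map_C]
      rw [← Equiv.prod_comp σ (fun i => Polynomial.X - Polynomial.C (α i))]
      exact Finset.prod_congr rfl fun i _ => by rw [← hσ]; rfl
    conv_rhs => rw [← this, Polynomial.coeff_map]
    rfl
  obtain ⟨f, hf, hfd, hfm⟩ := Polynomial.lifts_and_natDegree_eq_and_monic hl hm
  exact ⟨f, hf, hfd.trans hd, hfm⟩

theorem stmt_2_aux {k L : Type u} [Field k] [Field L] [Algebra k L] [IsGalois k L]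
    [FiniteDimensional k L] [CharP L 2] (H5 : Subgroup (Equiv.Perm (Fin 5)))
    (e : (L ≃ₐ[k] L) ≃* VSemidirect H5) :
    ∃ (α x : Fin 5 → L), (∀ i, x i ^ 2 + x i + α i = 0) ∧ Function.Injective α ∧
      (∀ g : L ≃ₐ[k] L, ∃ σ : Equiv.Perm (Fin 5), ∀ i, g (α i) = α (σ i)) ∧
      IntermediateField.adjoin k (Set.range fun i : Fin 4 => x i.castSucc) = ⊤ := by
  classical
  let v : (L ≃ₐ[k] L) → Fin 5 → ZMod 2 := fun g => ((e g).left.toAdd : evenSum).1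
  let s : (L ≃ₐ[k] L) → Equiv.Perm (Fin 5) := fun g => ((e g).right : Equiv.Perm (Fin 5))
  have hv0 : ∀ g, ∑ i, v g i = 0 := fun g => ((e g).left.toAdd : evenSum).2
  have hvm : ∀ h g i, v (h * g) (s h i) = v h (s h i) + v g i := by
    intro h g i
    have : v (h * g) (s h i) = v h (s h i) + v g ((s h).symm (s h i)) := by
      simp only [v, s, map_mul]; rfl
    simpa using this
  let c : ZMod 2 →+* L := ZMod.castHom (dvd_refl 2) L
  have hgc : ∀ (g : L ≃ₐ[k] L) a, g (c a) = c a := by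
    intro g a
    exact congrArg (fun f : ZMod 2 →+* L => f a) (Subsingleton.elim ((g : L →+* L).comp c) c)
  have hcc : ∀ a, c a ^ 2 + c a = 0 := by
    intro a
    rw [← map_pow, ← map_add, ← map_zero c]
    congr 1
    revert a; decide
  obtain ⟨t, ht⟩ := Algebra.trace_surjective k L 1
  have ht1 : ∑ g : L ≃ₐ[k] L, g t = 1 := by
    rw [← trace_eq_sum_automorphisms, ht, map_one]
  let x : Fin 5 → L := fun i => ∑ g : L ≃ₐ[k] L, c (v g i) * g t
  have hgx : ∀ h i, h (x i) = x (s h i) + c (v h (s h i)) := by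
    intro h i
    have h1 : x (s h i) = ∑ g : L ≃ₐ[k] L, c (v (h * g) (s h i)) * (h * g) t :=
      (Equiv.sum_comp (Equiv.mulLeft h) (fun g : L ≃ₐ[k] L => c (v g (s h i)) * g t)).symm
    have h2 : ∑ g : L ≃ₐ[k] L, (h * g) t = 1 :=
      (Equiv.sum_comp (Equiv.mulLeft h) (fun g : L ≃ₐ[k] L => g t)).trans ht1
    have h3 : h (x i) = ∑ g : L ≃ₐ[k] L, c (v g i) * (h * g) t := by
      simp only [x, map_sum, map_mul, hgc]; rfl
    have h4 : x (s h i) = c (v h (s h i)) + h (x i) := by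
      rw [h1, h3]
      simp only [hvm, map_add, add_mul, Finset.sum_add_distrib, ← Finset.mul_sum, h2, mul_one]
    rw [h4]
    have := CharTwo.add_self_eq_zero (c (v h (s h i)))
    linear_combination -this
  let α : Fin 5 → L := fun i => x i ^ 2 + x i
  have hgα : ∀ g i, g (α i) = α (s g i) := by
    intro g i
    simp only [α, map_add, map_pow, hgx]
    have h1 := hcc (v g (s g i))
    have h2 := CharTwo.add_self_eq_zero (x (s g i) * c (v g (s g i)))
    linear_combination h1 + h2
  have hαi : Function.Injective α := by
    intro i j hij
    by_contra hne
    have hz : (x i + x j) * (x i + x j + 1) = 0 := by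
      have h2 := CharTwo.add_self_eq_zero (x i * x j)
      have h3 := CharTwo.add_self_eq_zero (α j)
      have : x i ^ 2 + x i = α j := hij
      have h4 : x j ^ 2 + x j = α j := rfl
      linear_combination h2 + h3 + this + h4
    have hinv : ∀ g : L ≃ₐ[k] L, g (x i + x j) = x i + x j := by
      intro g
      rcases mul_eq_zero.1 hz with h | h
      · rw [h, map_zero]
      · rw [eq_neg_of_add_eq_zero_left h, map_neg, map_one]
    obtain ⟨w, hw0, hw⟩ : ∃ w : Fin 5 → ZMod 2, ∑ l, w l = 0 ∧ w i + w j = 1 := by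
      have hl : ∀ a b : Fin 5, ∃ l, l ≠ a ∧ l ≠ b := by decide
      obtain ⟨l, hli, hlj⟩ := hl i j
      refine ⟨Pi.single i 1 + Pi.single l 1, ?_, ?_⟩
      · simp only [Pi.add_apply, Finset.sum_add_distrib, Finset.sum_pi_single', Finset.mem_univ,
          if_true]
        decide
      · simp [Pi.single_apply, hli.symm, hlj.symm, Ne.symm hne]
    let g := e.symm ⟨Multiplicative.ofAdd (⟨w, hw0⟩ : evenSum), 1⟩
    have hvg : v g = w := by simp [v, g]
    have hsg : s g = 1 := by simp [s, g]
    have := hinv g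
    rw [map_add, hgx, hgx, hvg, hsg] at this
    simp only [Equiv.Perm.coe_one, id_eq] at this
    have h1 : c (w i) + c (w j) = 1 := by rw [← map_add, hw, map_one]
    exact one_ne_zero (α := L) (by linear_combination this - h1)
  refine ⟨α, x, fun i => CharTwo.add_self_eq_zero _, hαi, fun g => ⟨s g, hgα g⟩, ?_⟩
  set K := IntermediateField.adjoin k (Set.range fun i : Fin 4 => x i.castSucc) with hK
  have hbot : K.fixingSubgroup = ⊥ := by
    rw [eq_bot_iff]
    intro g hg
    rw [IntermediateField.mem_fixingSubgroup_iff] at hg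
    have hgx' : ∀ i : Fin 4, g (x i.castSucc) = x i.castSucc := fun i =>
      hg _ (IntermediateField.subset_adjoin k _ ⟨i, rfl⟩)
    have hs4 : ∀ i : Fin 4, s g i.castSucc = i.castSucc := by
      intro i
      apply hαi
      rw [← hgα]
      simp only [α, map_add, map_pow, hgx']
    have hs : s g = 1 := by
      refine Equiv.ext fun i => ?_
      refine Fin.lastCases ?_ hs4 i
      rcases Fin.eq_castSucc_or_eq_last (s g (Fin.last 4)) with ⟨j, hj⟩ | h
      · have := (s g).injective (hj.trans (hs4 j).symm)
        exact absurd this (Fin.castSucc_lt_last j).ne'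
      · exact h
    have hv4 : ∀ i : Fin 4, v g i.castSucc = 0 := by
      intro i
      have := hgx g i.castSucc
      rw [hgx', hs4] at this
      have h0 : c (v g i.castSucc) = 0 := by linear_combination -this
      exact c.injective (h0.trans (map_zero c).symm)
    have hv : v g = 0 := by
      have h5 := hv0 g
      rw [Fin.sum_univ_castSucc] at h5
      simp only [hv4, Finset.sum_const_zero, zero_add] at h5
      funext i
      refine Fin.lastCases h5 hv4 i
    rw [Subgroup.mem_bot]
    apply e.injective
    rw [map_one]
    refine SemidirectProduct.ext ?_ ?_
    · exact Subtype.ext hv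
    · exact Subtype.ext hs
  rw [← IsGalois.fixedField_fixingSubgroup K, hbot, IntermediateField.fixedField_bot]

/-- Let `k` be an infinite field of characteristic 2 with separable closure `k_s`, and let
`G = V ⋊ G₅` where `G₅ ≤ S₅` is either the cyclic group generated by a 5-cycle or `A₅`. If `k`
admits a Galois extension with group `G`, then there is a monic separable quintic `f ∈ k[x]`
with distinct roots `α₁, …, α₅ ∈ k_s` and elements `x₁, …, x₄ ∈ k_s` with `xᵢ² + xᵢ + αᵢ = 0`,
such that `L' = k(x₁, x₂, x₃, x₄) ⊆ k_s` is Galois over `k` with `Gal(L'/k) ≅ G`. -/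
theorem stmt_2 {k k_s : Type u} [Field k] [Infinite k] [CharP k 2]
    [Field k_s] [Algebra k k_s] [IsSepClosure k k_s]
    (H5 : Subgroup (Equiv.Perm (Fin 5)))
    (hH5 : H5 = Subgroup.zpowers (finRotate 5) ∨ H5 = alternatingGroup (Fin 5))
    (hGal : ∃ (L : Type u) (_ : Field L) (_ : Algebra k L), IsGalois k L ∧
      Nonempty ((L ≃ₐ[k] L) ≃* VSemidirect H5)) :
    ∃ (f : Polynomial k) (α : Fin 5 → k_s) (x : Fin 4 → k_s),
      f.Monic ∧ f.Separable ∧ f.natDegree = 5 ∧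
      Function.Injective α ∧ (∀ i, Polynomial.aeval (α i) f = 0) ∧
      (∀ i : Fin 4, x i ^ 2 + x i + α i.castSucc = 0) ∧
      IsGalois k ↥(IntermediateField.adjoin k (Set.range x)) ∧
      Nonempty ((↥(IntermediateField.adjoin k (Set.range x)) ≃ₐ[k]
        ↥(IntermediateField.adjoin k (Set.range x))) ≃* VSemidirect H5) := by
  classical
  obtain ⟨L, _, _, hG, ⟨e⟩⟩ := hGal
  haveI : Finite ↥evenSum := inferInstance
  haveI : Finite (Multiplicative ↥evenSum) := inferInstanceAs (Finite ↥evenSum)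
  haveI : Finite (VSemidirect H5) :=
    Finite.of_injective (fun g => (g.left, g.right)) (by
      intro a b h
      simp only [Prod.mk.injEq] at h
      exact SemidirectProduct.ext h.1 h.2)
  haveI : Finite (L ≃ₐ[k] L) := Finite.of_equiv _ e.toEquiv.symm
  haveI : FiniteDimensional k L := stmt_2_finite k L
  haveI : CharP L 2 := charP_of_injective_algebraMap (algebraMap k L).injective 2
  obtain ⟨α, x, hx, hα, hfix, htop⟩ := stmt_2_aux H5 e
  obtain ⟨f, hf, hfd, hfm⟩ := stmt_2_poly k α hfix
  haveI : IsSepClosed k_s := IsSepClosure.sep_closed k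
  let φ : L →ₐ[k] k_s := IsSepClosed.lift
  have key : IntermediateField.adjoin k (Set.range fun i : Fin 4 => φ (x i.castSucc))
      = φ.fieldRange := by
    have : (Set.range fun i : Fin 4 => φ (x i.castSucc))
        = φ '' (Set.range fun i : Fin 4 => x i.castSucc) := by
      rw [← Set.range_comp]; rfl
    rw [this, ← IntermediateField.adjoin_map, htop, AlgHom.fieldRange_eq_map]
  refine ⟨f, fun i => φ (α i), fun i => φ (x i.castSucc), hfm, ?_, hfd,
    fun i j h => hα (φ.injective h), ?_, ?_, ?_⟩
  · rw [← Polynomial.separable_map (algebraMap k L), hf, Polynomial.separable_prod_X_sub_C_iff]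
    exact hα
  · intro i
    rw [Polynomial.aeval_algHom_apply, Polynomial.aeval_def, ← Polynomial.eval_map, hf,
      Polynomial.eval_prod, Finset.prod_eq_zero (Finset.mem_univ i) (by simp), map_zero]
  · intro i
    rw [← map_pow, ← map_add, ← map_add, hx, map_zero]
  · rw [key]
    have E : L ≃ₐ[k] φ.fieldRange := AlgEquiv.ofInjectiveField φ
    exact ⟨IsGalois.of_algEquiv E, ⟨(AlgEquiv.autCongr E).symm.trans e⟩⟩
end

section
/- Let k be an infinite field of characteristic 2. Let V = {v ∈ 𝔽₂⁵ : v₁ + ⋯ + v₅ = 0}, let G₅ ≤ S₅ be either the cyclic subgroup of order 5 generated by the 5-cycle (1 2 3 4 5) or the alternating group A₅, acting on V by permuting coordinates, and set G = V ⋊ G₅. Suppose there exists a Galois field extension of k with Galois group isomorphic to G. Then there exists a monic separable quintic polynomial f ∈ k[x] such that the Galois group of f over k (i.e. the Galois group of its splitting field over k) is isomorphic to G₅, and the Galois group over k of the degree-10 polynomial f(x² + x) is isomorphic to G. -/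
universe u

open Polynomial in
theorem aux_restrict {k L : Type u} [Field k] [Field L] [Algebra k L] [IsGalois k L]
    {M : Type} [Group M] (q : k[X]) (hs : (q.map (algebraMap k L)).Splits)
    (r : (L ≃ₐ[k] L) →* M) (hr : Function.Surjective r)
    (hk : ∀ g : L ≃ₐ[k] L, r g = 1 ↔ ∀ x ∈ q.rootSet L, g x = x) :
    Nonempty (q.Gal ≃* M) := by
  have : Fact ((q.map (algebraMap k L)).Splits) := ⟨hs⟩
  have hker : (Polynomial.Gal.restrict q L).ker = r.ker := by
    ext g
    rw [MonoidHom.mem_ker, MonoidHom.mem_ker, hk]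
    constructor
    · intro h x hx
      have := Polynomial.Gal.restrict_smul g (⟨x, hx⟩ : q.rootSet L)
      rw [h, one_smul] at this
      exact this.symm
    · intro h
      apply Polynomial.Gal.galActionHom_injective q L
      ext x
      rw [Polynomial.Gal.galActionHom_restrict, map_one]
      exact h x x.2
  exact ⟨(QuotientGroup.quotientKerEquivOfSurjective _
      (Polynomial.Gal.restrict_surjective q L)).symm.trans
    ((QuotientGroup.quotientMulEquivOfEq hker).trans
      (QuotientGroup.quotientKerEquivOfSurjective r hr))⟩

theorem aux_trace {k L : Type u} [Field k] [Field L] [Algebra k L] [Fintype (L ≃ₐ[k] L)] :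
    ∃ θ : L, ∑ g : L ≃ₐ[k] L, g θ = 1 := by
  obtain ⟨y, hy⟩ : ∃ y : L, ∑ g : L ≃ₐ[k] L, g y ≠ 0 := by
    by_contra! h
    have hi := (linearIndependent_monoidHom L L).comp
      (fun g : L ≃ₐ[k] L => (g : L →* L)) (by
        intro a b hab
        ext x
        exact DFunLike.congr_fun hab x)
    rw [Fintype.linearIndependent_iff] at hi
    have := hi (fun _ => 1) (by
      funext y
      simpa using h y) 1
    exact one_ne_zero this
  set t := ∑ g : L ≃ₐ[k] L, g y with ht
  have hfix : ∀ h : L ≃ₐ[k] L, h t = t := by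
    intro h
    rw [ht, map_sum]
    exact Fintype.sum_equiv (Equiv.mulLeft h) _ _ (fun g => rfl)
  refine ⟨t⁻¹ * y, ?_⟩
  simp only [map_mul, map_inv₀, hfix]
  rw [← Finset.mul_sum, ← ht, inv_mul_cancel₀ hy]

/-- the `i`-th coordinate of the `V` part -/
def vc {H5 : Subgroup (Equiv.Perm (Fin 5))} (a : VSemidirect H5) (i : Fin 5) : ZMod 2 :=
  (Multiplicative.toAdd a.left : evenSum).1 i

theorem vc_mul {H5 : Subgroup (Equiv.Perm (Fin 5))} (a b : VSemidirect H5) (i : Fin 5) :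
    vc (a * b) (a.right.1 i) = vc a (a.right.1 i) + vc b i := by
  have : vc (a * b) (a.right.1 i)
      = vc a (a.right.1 i) + vc b (a.right.1.symm (a.right.1 i)) := rfl
  rw [this, Equiv.symm_apply_apply]

theorem exists_v (i j : Fin 5) (h : i ≠ j) : ∃ v : evenSum, v.1 i = 1 ∧ v.1 j = 0 := by
  have : ∃ v : Fin 5 → ZMod 2, ∑ l, v l = 0 ∧ v i = 1 ∧ v j = 0 := by
    obtain ⟨m, hm1, hm2⟩ : ∃ m : Fin 5, m ≠ i ∧ m ≠ j := by revert i j; decide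
    refine ⟨Pi.single i 1 + Pi.single m 1, ?_, ?_, ?_⟩
    · simp only [Pi.add_apply, Finset.sum_add_distrib, Finset.sum_pi_single', Finset.mem_univ,
        if_true]
      decide
    · simp [hm1.symm]
    · simp [h.symm, hm2.symm]
  obtain ⟨v, h0, h1, h2⟩ := this
  exact ⟨⟨v, h0⟩, h1, h2⟩

/-- Let `k` be an infinite field of characteristic 2 and let `G = V ⋊ G₅` where `G₅ ≤ S₅` is
either the cyclic group generated by a 5-cycle or `A₅`. If `k` admits a Galois extension with
Galois group isomorphic to `G`, then there is a monic separable quintic `f ∈ k[x]` whose Galois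
group over `k` is isomorphic to `G₅` and such that the Galois group of the degree-10 polynomial
`f(x² + x)` over `k` is isomorphic to `G`. -/
theorem stmt_3 {k : Type u} [Field k] [Infinite k] [CharP k 2]
    (H5 : Subgroup (Equiv.Perm (Fin 5)))
    (hH5 : H5 = Subgroup.zpowers (finRotate 5) ∨ H5 = alternatingGroup (Fin 5))
    (hGal : ∃ (L : Type u) (_ : Field L) (_ : Algebra k L), IsGalois k L ∧
      Nonempty ((L ≃ₐ[k] L) ≃* VSemidirect H5)) :
    ∃ f : Polynomial k, f.Monic ∧ f.Separable ∧ f.natDegree = 5 ∧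
      Nonempty (f.Gal ≃* ↥H5) ∧
      Nonempty ((f.comp (Polynomial.X ^ 2 + Polynomial.X)).Gal ≃* VSemidirect H5) := by
  obtain ⟨L, _, _, hG, ⟨e⟩⟩ := hGal
  have hfinV : Finite (VSemidirect H5) := Finite.of_equiv _ SemidirectProduct.equivProd.symm
  have hfin : Finite (L ≃ₐ[k] L) := Finite.of_equiv _ e.symm.toEquiv
  have : Fintype (L ≃ₐ[k] L) := Fintype.ofFinite _
  have : CharP L 2 := charP_of_injective_algebraMap (algebraMap k L).injective 2
  obtain ⟨θ, hθ⟩ := aux_trace (k := k) (L := L)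
  let ρ : ZMod 2 →+* L := ZMod.castHom (dvd_refl 2) L
  have hρ : ∀ (g : L ≃ₐ[k] L) (a : ZMod 2), g (ρ a) = ρ a := fun g a =>
    RingHom.congr_fun (Subsingleton.elim (((g : L ≃+* L) : L →+* L).comp ρ) ρ) a
  let x : Fin 5 → L := fun i => ∑ g : L ≃ₐ[k] L, ρ (vc (e g) i) * g θ
  have hx : ∀ (h : L ≃ₐ[k] L) (i : Fin 5),
      h (x i) = x ((e h).right.1 i) + ρ (vc (e h) ((e h).right.1 i)) := by
    intro h i
    have h1 : x ((e h).right.1 i)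
        = ∑ g : L ≃ₐ[k] L, ρ (vc (e (h * g)) ((e h).right.1 i)) * (h * g) θ :=
      (Fintype.sum_equiv (Equiv.mulLeft h) _ _ (fun g => rfl)).symm
    have h2 : ∑ g : L ≃ₐ[k] L, (h * g) θ = 1 := by
      rw [← hθ]
      exact Fintype.sum_equiv (Equiv.mulLeft h) _ _ (fun g => rfl)
    have h3 : h (x i) = ∑ g : L ≃ₐ[k] L, ρ (vc (e g) i) * (h * g) θ := by
      simp only [x, map_sum, map_mul, hρ]
      rfl
    rw [h1, h3]
    simp only [map_mul e, vc_mul, map_add, add_mul, Finset.sum_add_distrib]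
    rw [← Finset.mul_sum, h2, mul_one, add_right_comm, CharTwo.add_self_eq_zero, zero_add]
  have hρ2 : ∀ a : ZMod 2, ρ a ^ 2 + ρ a = 0 := by
    intro a
    rw [← map_pow, ← map_add]
    have : a ^ 2 + a = 0 := by revert a; decide
    rw [this, map_zero]
  let α : Fin 5 → L := fun i => x i ^ 2 + x i
  have hα : ∀ (h : L ≃ₐ[k] L) (i : Fin 5), h (α i) = α ((e h).right.1 i) := by
    intro h i
    simp only [α, map_add, map_pow, hx]
    rw [CharTwo.add_sq]
    linear_combination hρ2 (vc (e h) ((e h).right.1 i))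
  have hroot : ∀ y z : L, y ^ 2 + y = z ^ 2 + z → y = z ∨ y = z + 1 := by
    intro y z h
    have h2 : (2 : L) = 0 := CharTwo.two_eq_zero
    have : (y - z) * (y - (z + 1)) = 0 := by
      linear_combination h + (z ^ 2 - y * z - y + z) * h2
    rcases mul_eq_zero.1 this with h | h
    · exact Or.inl (sub_eq_zero.1 h)
    · exact Or.inr (sub_eq_zero.1 h)
  have hinj : Function.Injective α := by
    intro i j hij
    by_contra hne
    obtain ⟨v, hv1, hv2⟩ := exists_v i j hne
    let h : L ≃ₐ[k] L := e.symm (SemidirectProduct.inl (Multiplicative.ofAdd v))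
    have he : e h = SemidirectProduct.inl (Multiplicative.ofAdd v) := e.apply_symm_apply _
    have hi : h (x i) = x i + 1 := by
      have h1 := hx h i
      rw [he] at h1
      rw [h1]
      have : ρ (v.1 i) = 1 := by rw [hv1, map_one]
      exact congrArg (x i + ·) this
    have hj : h (x j) = x j := by
      have h1 := hx h j
      rw [he] at h1
      rw [h1]
      have : ρ (v.1 j) = 0 := by rw [hv2, map_zero]
      exact (congrArg (x j + ·) this).trans (add_zero _)
    rcases hroot _ _ hij with h1 | h1
    · have h2 := congrArg h h1
      rw [hi, hj, h1] at h2
      simp at h2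
    · have h2 := congrArg h h1
      rw [map_add, map_one, hi, hj, h1] at h2
      simp at h2
  let F : Polynomial L := ∏ i, (Polynomial.X - Polynomial.C (α i))
  have hFm : F.Monic := Polynomial.monic_prod_X_sub_C _ _
  have hFlift : F ∈ Polynomial.lifts (algebraMap k L) := by
    rw [Polynomial.lifts_iff_coeff_lifts]
    intro n
    rw [InfiniteGalois.mem_range_algebraMap_iff_fixed]
    intro g
    have : F.map ((g : L ≃+* L) : L →+* L) = F := by
      simp only [F, Polynomial.map_prod, Polynomial.map_sub, Polynomial.map_X, Polynomial.map_C]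
      refine Fintype.prod_equiv (e g).right.1 _ _ fun i => ?_
      rw [← hα g i]
      rfl
    have h2 := congrArg (fun p => Polynomial.coeff p n) this
    simp only [Polynomial.coeff_map] at h2
    exact h2
  obtain ⟨f, hfF, hdeg, hmon⟩ := Polynomial.lifts_and_natDegree_eq_and_monic hFlift hFm
  have hF5 : F.natDegree = 5 := by simp [F]
  have hFs : F.Splits := Polynomial.Splits.prod fun i _ => Polynomial.Splits.X_sub_C _
  have hcomp : (f.comp (Polynomial.X ^ 2 + Polynomial.X)).map (algebraMap k L)
      = ∏ i, ((Polynomial.X - Polynomial.C (x i)) * (Polynomial.X - Polynomial.C (x i + 1))) := by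
    rw [Polynomial.map_comp, hfF]
    simp only [F, Polynomial.prod_comp]
    refine Finset.prod_congr rfl fun i _ => ?_
    have h2 : (2 : Polynomial L) = 0 := CharTwo.two_eq_zero
    simp [α]
    linear_combination (Polynomial.X * Polynomial.C (x i) + Polynomial.X
      - Polynomial.C (x i) ^ 2 - Polynomial.C (x i)) * h2
  have hroots1 : ∀ y, y ∈ f.rootSet L ↔ ∃ i, y = α i := by
    intro y
    rw [Polynomial.mem_rootSet, ← Polynomial.eval_map_algebraMap, hfF]
    simp [F, Polynomial.eval_prod, Finset.prod_eq_zero_iff, sub_eq_zero, hmon.ne_zero]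
  have hne : f.comp (Polynomial.X ^ 2 + Polynomial.X) ≠ 0 := by
    intro h
    rw [h, Polynomial.map_zero] at hcomp
    have := hcomp.symm
    rw [Finset.prod_eq_zero_iff] at this
    obtain ⟨i, -, hi⟩ := this
    exact mul_ne_zero (Polynomial.X_sub_C_ne_zero _) (Polynomial.X_sub_C_ne_zero _) hi
  have hroots2 : ∀ y, y ∈ (f.comp (Polynomial.X ^ 2 + Polynomial.X)).rootSet L ↔
      ∃ i, y = x i ∨ y = x i + 1 := by
    intro y
    rw [Polynomial.mem_rootSet, ← Polynomial.eval_map_algebraMap, hcomp]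
    simp only [Polynomial.eval_prod, Finset.prod_eq_zero_iff, Polynomial.eval_mul,
      Polynomial.eval_sub, Polynomial.eval_X, Polynomial.eval_C, mul_eq_zero, sub_eq_zero,
      Finset.mem_univ, true_and, ne_eq, hne, not_false_eq_true]
  have hright : ∀ g : L ≃ₐ[k] L, (∀ i, g (α i) = α i) → (e g).right = 1 := by
    intro g hg
    apply Subtype.ext
    apply Equiv.ext
    intro i
    exact hinj ((hα g i).symm.trans (hg i))
  refine ⟨f, hmon, ?_, hdeg.trans hF5, ?_, ?_⟩
  · rw [← Polynomial.separable_map (algebraMap k L), hfF]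
    exact Polynomial.separable_prod_X_sub_C_iff.2 hinj
  · refine aux_restrict (L := L) f (by rw [hfF]; exact hFs)
      (SemidirectProduct.rightHom.comp e.toMonoidHom)
      (SemidirectProduct.rightHom_surjective.comp e.surjective) fun g => ?_
    constructor
    · intro hg y hy
      obtain ⟨i, rfl⟩ := (hroots1 y).1 hy
      have h1 : (e g).right = 1 := hg
      rw [hα, h1]
      rfl
    · intro hg
      exact hright g fun i => hg _ ((hroots1 _).2 ⟨i, rfl⟩)
  · refine aux_restrict (L := L) _ (by
        rw [hcomp]
        exact Polynomial.Splits.prod fun i _ =>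
          (Polynomial.Splits.X_sub_C _).mul (Polynomial.Splits.X_sub_C _))
      e.toMonoidHom e.surjective fun g => ?_
    constructor
    · intro hg y hy
      have h1 : e g = 1 := hg
      rw [(map_eq_one_iff e e.injective).1 h1]
      rfl
    · intro hg
      have hgx : ∀ i, g (x i) = x i := fun i => hg _ ((hroots2 _).2 ⟨i, Or.inl rfl⟩)
      have h1 := hright g fun i => by simp only [α, map_add, map_pow, hgx]
      refine SemidirectProduct.ext ?_ h1
      apply Subtype.ext
      funext i
      have h2 := hx g i
      rw [hgx, h1] at h2
      have h3 : ρ (vc (e g) i) = 0 := by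
        have h4 : x i = x i + ρ (vc (e g) i) := h2
        exact left_eq_add.1 h4
      exact (map_eq_zero ρ).1 h3
end

section
/- Let k be a field and n ≥ 2 an integer, and assume that k admits a separable field extension of degree n. Let a ∈ k, and assume a ≠ 0 in the case that char(k) = 2 and n = 2. Then there exists a monic, separable, irreducible polynomial f ∈ k[t] of degree n whose coefficient of t^{n−1} equals a. -/
universe u

open IntermediateField Polynomial in
theorem aux_final {k L : Type u} [Field k] [Field L] [Algebra k L] [FiniteDimensional k L]
    [Algebra.IsSeparable k L] (n : ℕ) (hn : 2 ≤ n) (h : Module.finrank k L = n) (a : k) (x : L)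
    (hx : k⟮x⟯ = ⊤) (ht : Algebra.trace k L x = -a) :
    ∃ f : Polynomial k, f.Monic ∧ f.Separable ∧ Irreducible f ∧
      f.natDegree = n ∧ f.coeff (n - 1) = a := by
  have hi : IsIntegral k x := Algebra.IsIntegral.isIntegral x
  have hd : (minpoly k x).natDegree = n := by
    rw [← h]; exact (Field.primitive_element_iff_minpoly_natDegree_eq k x).1 hx
  refine ⟨minpoly k x, minpoly.monic hi, Algebra.IsSeparable.isSeparable k x,
    minpoly.irreducible hi, hd, ?_⟩
  have h1 := trace_eq_finrank_mul_minpoly_nextCoeff k x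
  have h2 : Module.finrank k⟮x⟯ L = 1 := by
    rw [hx]; exact IntermediateField.finrank_top
  rw [ht, h2, nextCoeff_of_natDegree_pos (by omega), hd] at h1
  simpa using h1.symm

theorem aux_div {d n : ℕ} (h : d ∣ n) (hlt : d ≠ n) (hn : 3 ≤ n) : d ≤ n / 2 := by
  obtain ⟨c, rfl⟩ := h
  have : c ≠ 1 := by rintro rfl; simp at hlt
  have : c ≠ 0 := by rintro rfl; simp at hn
  have : 2 ≤ c := by omega
  rw [Nat.le_div_iff_mul_le (by norm_num)]
  exact Nat.mul_le_mul_left _ this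

open IntermediateField in
theorem aux_two {k L : Type u} [Field k] [Field L] [Algebra k L] [FiniteDimensional k L]
    [Algebra.IsSeparable k L] (h : Module.finrank k L = 2) (a : k)
    (ha : ringChar k = 2 → a ≠ 0) : ∃ x : L, k⟮x⟯ = ⊤ ∧ Algebra.trace k L x = -a := by
  have key : ∀ x : L, x ∉ (⊥ : IntermediateField k L) → k⟮x⟯ = ⊤ := by
    intro x hx
    have h1 : Module.finrank k k⟮x⟯ ∣ 2 := h ▸ ⟨_, (Module.finrank_mul_finrank k k⟮x⟯ L).symm⟩
    rcases (Nat.dvd_prime Nat.prime_two).1 h1 with h1 | h1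
    · rw [IntermediateField.finrank_eq_one_iff] at h1
      exact absurd (h1 ▸ mem_adjoin_simple_self k x) hx
    · exact IntermediateField.eq_of_le_of_finrank_eq le_top (by rw [h1, finrank_top', h])
  by_cases h2 : (2 : k) = 0
  · have hc : ringChar k = 2 := by
      have : CharP k 2 := CharTwo.of_one_ne_zero_of_two_eq_zero one_ne_zero h2
      exact ringChar.eq k 2
    obtain ⟨x, hx⟩ := Algebra.trace_surjective k L (-a)
    refine ⟨x, key x ?_, hx⟩
    intro hb
    obtain ⟨c, rfl⟩ := IntermediateField.mem_bot.1 hb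
    rw [Algebra.trace_algebraMap, h] at hx
    apply ha hc
    have : 2 • c = 0 := by rw [two_nsmul, ← two_mul, h2, zero_mul]
    rw [this] at hx
    simpa using hx.symm
  · have : ∃ y : L, y ∉ (⊥ : IntermediateField k L) := by
      by_contra! hcon
      have : (⊥ : IntermediateField k L) = ⊤ := by
        ext y; simp [hcon y]
      have h3 := IntermediateField.finrank_bot (F := k) (E := L)
      rw [this, finrank_top', h] at h3
      omega
    obtain ⟨y, hy⟩ := this
    set c : k := (-a - Algebra.trace k L y) / 2 with hc
    refine ⟨y + algebraMap k L c, key _ ?_, ?_⟩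
    · intro hb
      apply hy
      have := sub_mem hb (IntermediateField.algebraMap_mem ⊥ c)
      simpa using this
    · rw [map_add, Algebra.trace_algebraMap, h, two_nsmul, hc]
      field_simp
      ring

theorem aux_ker {k L : Type u} [Field k] [Field L] [Algebra k L] [FiniteDimensional k L]
    [Algebra.IsSeparable k L] {n : ℕ} (h : Module.finrank k L = n) :
    Module.finrank k (LinearMap.ker (Algebra.trace k L)) = n - 1 := by
  have := LinearMap.finrank_range_add_finrank_ker (Algebra.trace k L)
  rw [LinearMap.range_eq_top.2 (Algebra.trace_surjective k L), finrank_top,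
    Module.finrank_self, h] at this
  omega

open IntermediateField in
theorem aux_inf {k L : Type u} [Field k] [Infinite k] [Field L] [Algebra k L]
    [FiniteDimensional k L]
    [Algebra.IsSeparable k L] (n : ℕ) (hn : 3 ≤ n) (h : Module.finrank k L = n) (a : k) :
    ∃ x : L, k⟮x⟯ = ⊤ ∧ Algebra.trace k L x = -a := by
  have hfin : Finite (IntermediateField k L) :=
    Field.finite_intermediateField_of_exists_primitive_element k L
      (Field.exists_primitive_element k L)
  have hT := Algebra.trace_surjective k L
  by_cases ha : a = 0
  · subst ha
    let K := LinearMap.ker (Algebra.trace k L)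
    by_contra! hcon
    let p : {F : IntermediateField k L // F ≠ ⊤} → Subspace k K :=
      fun F => (Subalgebra.toSubmodule F.1.toSubalgebra).comap K.subtype
    have hc : ⋃ i, (p i : Set K) = Set.univ := by
      rw [Set.eq_univ_iff_forall]
      intro x
      rw [Set.mem_iUnion]
      refine ⟨⟨k⟮(x : L)⟯, fun hx => hcon x hx ?_⟩, ?_⟩
      · simp
      · exact mem_adjoin_simple_self k (x : L)
    obtain ⟨⟨F, hF⟩, hp⟩ := Subspace.exists_eq_top_of_iUnion_eq_univ hc
    have hle : K ≤ Subalgebra.toSubmodule F.toSubalgebra := by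
      intro x hx
      have : (⟨x, hx⟩ : K) ∈ p ⟨F, hF⟩ := by rw [hp]; trivial
      exact this
    have h1 := Submodule.finrank_mono hle
    rw [aux_ker h] at h1
    have h2 : Module.finrank k F ∣ n := h ▸ ⟨_, (Module.finrank_mul_finrank k F L).symm⟩
    have h3 : Module.finrank k F ≠ n := fun h3 => hF
      (IntermediateField.eq_of_le_of_finrank_eq le_top (by rw [h3, finrank_top', h]))
    have h4 := aux_div h2 h3 hn
    have h5 : n - 1 ≤ Module.finrank k F := h1
    omega
  · have : ∃ x : L, k⟮x⟯ = ⊤ ∧ Algebra.trace k L x ≠ 0 := by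
      by_contra! hcon
      let p : Option {F : IntermediateField k L // F ≠ ⊤} → Subspace k L :=
        fun o => o.elim (LinearMap.ker (Algebra.trace k L))
          (fun F => Subalgebra.toSubmodule F.1.toSubalgebra)
      have hc : ⋃ i, (p i : Set L) = Set.univ := by
        rw [Set.eq_univ_iff_forall]
        intro x
        rw [Set.mem_iUnion]
        by_cases hx : k⟮x⟯ = ⊤
        · exact ⟨none, hcon x hx⟩
        · exact ⟨some ⟨k⟮x⟯, hx⟩, mem_adjoin_simple_self k x⟩
      obtain ⟨i, hp⟩ := Subspace.exists_eq_top_of_iUnion_eq_univ hc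
      rcases i with _ | ⟨F, hF⟩
      · obtain ⟨x, hx⟩ := hT 1
        have : x ∈ p none := by rw [hp]; trivial
        have : Algebra.trace k L x = 0 := this
        rw [hx] at this
        exact one_ne_zero this
      · apply hF
        rw [eq_top_iff]
        intro x _
        have : x ∈ p (some ⟨F, hF⟩) := by rw [hp]; trivial
        exact this
    obtain ⟨x, hx, ht⟩ := this
    set c := -a / Algebra.trace k L x with hc
    have hc0 : c ≠ 0 := div_ne_zero (neg_ne_zero.2 ha) ht
    refine ⟨c • x, ?_, ?_⟩
    · rw [eq_top_iff, ← hx, adjoin_simple_le_iff]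
      have := IntermediateField.smul_mem _ (mem_adjoin_simple_self k (c • x)) (x := c⁻¹)
      rwa [inv_smul_smul₀ hc0] at this
    · rw [map_smul, smul_eq_mul, hc, div_mul_cancel₀ _ ht]

open IntermediateField Polynomial in
theorem aux_fin {k L : Type u} [Field k] [Finite k] [Field L] [Algebra k L]
    [FiniteDimensional k L]
    [Algebra.IsSeparable k L] (n : ℕ) (hn : 3 ≤ n) (h : Module.finrank k L = n) (a : k) :
    ∃ x : L, k⟮x⟯ = ⊤ ∧ Algebra.trace k L x = -a := by
  classical
  by_contra! hcon
  have : Finite L := Module.finite_of_finite k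
  let q := Nat.card k
  have hq : 1 < q := Finite.one_lt_card
  obtain ⟨y, hy⟩ := Algebra.trace_surjective k L (-a)
  let K := LinearMap.ker (Algebra.trace k L)
  have hK : Nat.card K = q ^ (n - 1) := by
    rw [← aux_ker h]; exact Module.natCard_eq_pow_finrank
  let B : Finset L := (Finset.Icc 1 (n / 2)).biUnion fun d => (X ^ q ^ d - X : L[X]).roots.toFinset
  have hB : B.card < q ^ (n / 2 + 1) := by
    calc B.card ≤ ∑ d ∈ Finset.Icc 1 (n / 2), (X ^ q ^ d - X : L[X]).roots.toFinset.card :=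
          Finset.card_biUnion_le
      _ ≤ ∑ d ∈ Finset.Icc 1 (n / 2), q ^ d := by
          refine Finset.sum_le_sum fun d hd => ?_
          have hd0 : d ≠ 0 := by have := Finset.mem_Icc.1 hd; omega
          calc _ ≤ Multiset.card (X ^ q ^ d - X : L[X]).roots := Multiset.toFinset_card_le _
            _ ≤ _ := card_roots' _
            _ = _ := FiniteField.X_pow_card_pow_sub_X_natDegree_eq L hd0 hq
      _ < q ^ (n / 2 + 1) := Nat.geomSum_lt hq fun d hd => by
          have := Finset.mem_Icc.1 hd; omega
  have hmem : ∀ z : K, y + (z : L) ∈ B := by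
    intro z
    have ht : Algebra.trace k L (y + z) = -a := by
      rw [map_add, hy, LinearMap.mem_ker.1 z.2, add_zero]
    set x := y + (z : L)
    have hx : k⟮x⟯ ≠ ⊤ := fun hx => hcon x hx ht
    have h2 : Module.finrank k k⟮x⟯ ∣ n := h ▸ ⟨_, (Module.finrank_mul_finrank k k⟮x⟯ L).symm⟩
    have h3 : Module.finrank k k⟮x⟯ ≠ n := fun h3 => hx
      (IntermediateField.eq_of_le_of_finrank_eq le_top (by rw [h3, finrank_top', h]))
    have h4 := aux_div h2 h3 hn
    have h5 : 0 < Module.finrank k k⟮x⟯ := Module.finrank_pos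
    refine Finset.mem_biUnion.2 ⟨Module.finrank k k⟮x⟯, Finset.mem_Icc.2 ⟨h5, h4⟩, ?_⟩
    rw [Multiset.mem_toFinset, mem_roots (FiniteField.X_pow_card_pow_sub_X_ne_zero L h5.ne' hq)]
    have h6 : Nat.card k⟮x⟯ = q ^ Module.finrank k k⟮x⟯ := Module.natCard_eq_pow_finrank
    have : Fintype k⟮x⟯ := Fintype.ofFinite _
    have h7 := FiniteField.pow_card (AdjoinSimple.gen k x)
    rw [← Nat.card_eq_fintype_card, h6] at h7
    have h8 := congrArg (algebraMap k⟮x⟯ L) h7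
    rw [map_pow, AdjoinSimple.algebraMap_gen] at h8
    simp [h8]
  have hle : Nat.card K ≤ B.card := by
    have := Nat.card_le_card_of_injective (fun z : K => (⟨y + z, hmem z⟩ : B)) (by
      intro z w hzw
      simpa using hzw)
    simpa using this
  have : q ^ (n / 2 + 1) ≤ q ^ (n - 1) := Nat.pow_le_pow_right (by omega) (by omega)
  omega

/-- **Prescribed penultimate coefficient lemma.** If `k` admits a separable field extension
of degree `n ≥ 2`, and `a ∈ k` (with `a ≠ 0` in case `char k = 2` and `n = 2`), then there is
a monic, separable, irreducible polynomial over `k` of degree `n` whose coefficient of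
`t^(n-1)` equals `a`. -/
theorem stmt_4 {k : Type u} [Field k] (n : ℕ) (hn : 2 ≤ n)
    (hext : ∃ (L : Type u) (_ : Field L) (_ : Algebra k L),
      Algebra.IsSeparable k L ∧ Module.finrank k L = n)
    (a : k) (ha : ringChar k = 2 → n = 2 → a ≠ 0) :
    ∃ f : Polynomial k, f.Monic ∧ f.Separable ∧ Irreducible f ∧
      f.natDegree = n ∧ f.coeff (n - 1) = a := by
  obtain ⟨L, _, _, _, h⟩ := hext
  have : FiniteDimensional k L := Module.finite_of_finrank_pos (by omega)
  have hx : ∃ x : L, IntermediateField.adjoin k {x} = ⊤ ∧ Algebra.trace k L x = -a := by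
    rcases Nat.lt_or_ge n 3 with h3 | h3
    · have h2 : n = 2 := by omega
      exact aux_two (h.trans h2) a fun hc => ha hc h2
    · rcases finite_or_infinite k with _ | _
      · exact aux_fin n h3 h a
      · exact aux_inf n h3 h a
  obtain ⟨x, hx, ht⟩ := hx
  exact aux_final n hn h a x hx ht
end

section
/- Let k be a field and let t₁,…,t₆ ∈ k be pairwise distinct. Then there exists a nonzero tuple (a, b, c, d, e, f) ∈ k⁶ with a + b·tᵢ + c·tᵢ² + d·tᵢ³ + e·tᵢ⁴ + f·tᵢ⁶ = 0 for all i = 1,…,6 if and only if t₁ + ⋯ + t₆ = 0. Equivalently, there is a nonzero quadratic form q(x, y, z) = a x² + b xy + c y² + d xz + e yz + f z² on k³ vanishing at all six vectors (1, tᵢ, tᵢ³) if and only if t₁ + ⋯ + t₆ = 0. -/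
/-- Six pairwise distinct parameters `t₁, …, t₆` admit a nonzero tuple `(a, b, c, d, e, f)`
with `a + b tᵢ + c tᵢ² + d tᵢ³ + e tᵢ⁴ + f tᵢ⁶ = 0` for all `i` (equivalently, the six points
`[1 : tᵢ : tᵢ³]` on the cuspidal cubic lie on a common conic) if and only if
`t₁ + ⋯ + t₆ = 0`. -/
theorem stmt_11 {k : Type*} [Field k] (t : Fin 6 → k) (hinj : Function.Injective t) :
    (∃ a b c d e f : k, ¬(a = 0 ∧ b = 0 ∧ c = 0 ∧ d = 0 ∧ e = 0 ∧ f = 0) ∧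
      ∀ i : Fin 6,
        a + b * t i + c * (t i) ^ 2 + d * (t i) ^ 3 + e * (t i) ^ 4 + f * (t i) ^ 6 = 0) ↔
    ∑ i, t i = 0 := by
  classical
  set P : Polynomial k := ∏ i : Fin 6, (Polynomial.X - Polynomial.C (t i)) with hP
  have hdeg : P.natDegree = 6 := by
    rw [hP, Polynomial.natDegree_finsetProd_X_sub_C_eq_card]; simp
  have hmonic : P.Monic := Polynomial.monic_prod_X_sub_C _ _
  have h6 : P.coeff 6 = 1 := by
    have := hmonic.coeff_natDegree
    rwa [hdeg] at this
  have h5 : P.coeff 5 = -∑ i, t i := by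
    have := Polynomial.prod_X_sub_C_coeff_card_pred (Finset.univ : Finset (Fin 6)) t (by simp)
    simpa using this
  have hev : ∀ i, P.eval (t i) = 0 := by
    intro i
    rw [hP, Polynomial.eval_prod]
    exact Finset.prod_eq_zero (Finset.mem_univ i) (by simp)
  constructor
  · rintro ⟨a, b, c, d, e, f, hne, h⟩
    have key : ∀ R : Polynomial k, R.natDegree < 6 → (∀ i, R.eval (t i) = 0) → R = 0 := by
      intro R hR hz
      exact Polynomial.eq_zero_of_natDegree_lt_card_of_eval_eq_zero R hinj hz (by simpa using hR)
    set Q : Polynomial k := Polynomial.C a + Polynomial.C b * Polynomial.X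
      + Polynomial.C c * Polynomial.X ^ 2 + Polynomial.C d * Polynomial.X ^ 3
      + Polynomial.C e * Polynomial.X ^ 4 + Polynomial.C f * Polynomial.X ^ 6 with hQ
    have hQd : Q.natDegree ≤ 6 := by rw [hQ]; compute_degree
    have hQc : ∀ n, Q.coeff n = (if n = 0 then a else 0) + (if n = 1 then b else 0)
        + (if n = 2 then c else 0) + (if n = 3 then d else 0) + (if n = 4 then e else 0)
        + (if n = 6 then f else 0) := by
      intro n
      simp [hQ, Polynomial.coeff_C, Polynomial.coeff_X, Polynomial.coeff_X_pow, eq_comm]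
    have hz : Q - Polynomial.C f * P = 0 := by
      apply key
      · have : (Q - Polynomial.C f * P).natDegree ≤ 5 := by
          rw [Polynomial.natDegree_le_iff_coeff_eq_zero]
          intro n hn
          rw [Polynomial.coeff_sub, Polynomial.coeff_C_mul]
          rcases Nat.lt_or_ge 6 n with h' | h'
          · rw [Polynomial.coeff_eq_zero_of_natDegree_lt (lt_of_le_of_lt hQd h'),
              Polynomial.coeff_eq_zero_of_natDegree_lt (hdeg ▸ h')]
            simp
          · obtain rfl : n = 6 := by omega
            rw [h6, hQc]; simp
        omega
      · intro i
        rw [Polynomial.eval_sub, Polynomial.eval_mul, hev, hQ]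
        simpa using h i
    have hQP := sub_eq_zero.mp hz
    have hc5 := congrArg (fun p => Polynomial.coeff p 5) hQP
    simp only [Polynomial.coeff_C_mul, h5, hQc] at hc5
    have hf : f ≠ 0 := by
      rintro rfl
      have hQ0 : Q = 0 := by simpa using hQP
      apply hne
      have g : ∀ n, Q.coeff n = 0 := by simp [hQ0]
      have g0 := g 0
      have g1 := g 1
      have g2 := g 2
      have g3 := g 3
      have g4 := g 4
      rw [hQc] at g0 g1 g2 g3 g4
      simp at g0 g1 g2 g3 g4
      exact ⟨g0, g1, g2, g3, g4, rfl⟩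
    simpa [hf] using hc5
  · intro hs
    refine ⟨P.coeff 0, P.coeff 1, P.coeff 2, P.coeff 3, P.coeff 4, 1, by simp, ?_⟩
    intro i
    have := hev i
    rw [Polynomial.eval_eq_sum_range, hdeg] at this
    simpa [Finset.sum_range_succ, h6, h5, hs] using this
end

section
/- Let k be a field of characteristic 3 with at least 37 elements, let K/k be a field extension, and let f ∈ k[t] be a monic separable polynomial of degree 7 that splits over K, with distinct roots r₁,…,r₇ ∈ K, and suppose f has no root in k. Then there exists α ∈ k such that rᵢ + α ≠ 0 for all i, and such that for all 1 ≤ i < j < ℓ ≤ 7 one has (rᵢ + α)⁻¹ + (r_j + α)⁻¹ + (r_ℓ + α)⁻¹ ≠ 0; equivalently, no three roots of the reciprocal polynomial f_α*(t) := f_α(0)⁻¹ · t⁷ · f_α(1/t) of f_α(t) := f(t − α) sum to zero. -/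
open Polynomial

/-- Over a field `k` of characteristic 3 with at least 37 elements, given a monic separable
polynomial `f` of degree 7 splitting over `K` with distinct roots `r 0, …, r 6` and with no root
in `k`, there is an `α ∈ k` with `rᵢ + α ≠ 0` for all `i` such that no three of the reciprocals
`(rᵢ + α)⁻¹` (the roots of the reciprocal polynomial of `f(t - α)`) sum to zero. -/
theorem stmt_13 {k K : Type*} [Field k] [CharP k 3] [Field K] [Algebra k K]
    (hcard : 37 ≤ Cardinal.mk k)
    (f : Polynomial k) (hmonic : f.Monic) (hsep : f.Separable) (hdeg : f.natDegree = 7)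
    (r : Fin 7 → K) (hr : Function.Injective r)
    (hsplit : f.map (algebraMap k K) = ∏ i, (X - C (r i)))
    (hnoroot : ∀ x : k, f.eval x ≠ 0) :
    ∃ α : k, (∀ i, r i + algebraMap k K α ≠ 0) ∧
      ∀ i j l : Fin 7, i < j → j < l →
        (r i + algebraMap k K α)⁻¹ + (r j + algebraMap k K α)⁻¹ +
          (r l + algebraMap k K α)⁻¹ ≠ 0 := by
  have hne : ∀ (α : k) i, r i + algebraMap k K α ≠ 0 := by
    intro α i h
    apply hnoroot (-α)
    apply (algebraMap k K).injective
    have h1 : (f.map (algebraMap k K)).eval (algebraMap k K (-α)) = 0 := by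
      rw [hsplit, eval_prod]
      apply Finset.prod_eq_zero (Finset.mem_univ i)
      simp only [eval_sub, eval_X, eval_C, map_neg]
      linear_combination -h
    rw [eval_map_algebraMap, aeval_algebraMap_apply] at h1
    simpa using h1
  have h3 : (3 : K) = 0 := by
    have : (3 : k) = 0 := by exact_mod_cast CharP.cast_eq_zero k 3
    rw [← map_ofNat (algebraMap k K) 3, this, map_zero]
  by_contra hcon
  push Not at hcon
  choose i j l hij hjl hs using fun α => hcon α (hne α)
  have key : ∀ α, (r (i α) * r (j α) + r (i α) * r (l α) + r (j α) * r (l α))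
      + 2 * algebraMap k K α * (r (i α) + r (j α) + r (l α)) = 0 := by
    intro α
    have h := hs α
    have a := hne α (i α)
    have b := hne α (j α)
    have c := hne α (l α)
    field_simp at h
    linear_combination h - (algebraMap k K α) ^ 2 * h3
  let T := {p : Fin 7 × Fin 7 × Fin 7 // p.1 < p.2.1 ∧ p.2.1 < p.2.2}
  have hT : Fintype.card T = 35 := by decide +kernel
  let g : k → T := fun α => ⟨(i α, j α, l α), hij α, hjl α⟩
  have hg : Function.Injective g := by
    intro α β h
    have h' := congrArg Subtype.val h
    simp only [g, Prod.mk.injEq] at h'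
    obtain ⟨e1, e2, e3⟩ := h'
    have ka := key α
    have kb := key β
    rw [← e1, ← e2, ← e3] at kb
    by_contra hab
    have hab' : algebraMap k K α - algebraMap k K β ≠ 0 :=
      sub_ne_zero.mpr fun h => hab ((algebraMap k K).injective h)
    have s0 : r (i α) + r (j α) + r (l α) = 0 := by
      apply (mul_eq_zero.mp _).resolve_left hab'
      linear_combination kb - ka +
        (algebraMap k K α - algebraMap k K β) * (r (i α) + r (j α) + r (l α)) * h3
    have d0 : (r (j α) - r (l α)) ^ 2 = 0 := by
      linear_combination -ka + (r (j α) + r (l α) + 2 * algebraMap k K α) * s0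
        - r (j α) * r (l α) * h3
    exact (hjl α).ne (hr (sub_eq_zero.mp (pow_eq_zero_iff two_ne_zero |>.mp d0)))
  have : Finite k := Finite.of_injective g hg
  have : Fintype k := Fintype.ofFinite k
  have h35 := Fintype.card_le_of_injective g hg
  rw [hT] at h35
  rw [Cardinal.mk_fintype] at hcard
  have : 37 ≤ Fintype.card k := by exact_mod_cast hcard
  omega
end

section
/- Let k be a field of characteristic 2 with at least 227 elements, let K/k be a field extension, and let f ∈ k[t] be a monic separable polynomial of degree 8 that splits over K, with distinct roots r₁,…,r₈ ∈ K, and suppose f has no root in k. Then there exists α ∈ k such that rᵢ + α ≠ 0 for all i, and such that for every subset S ⊆ {1,…,8} with |S| = 3 or |S| = 6 one has Σ_{i∈S}(rᵢ + α)⁻¹ ≠ 0. -/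
open Polynomial

theorem aux_deriv {K : Type*} [Field K] [CharP K 2] (r : Fin 8 → K) (hr : Function.Injective r)
    (S : Finset (Fin 8)) (hS : S.Nonempty) : derivative (∏ i ∈ S, (X - C (r i))) ≠ 0 := by
  intro h
  have hs : (∏ i ∈ S, (X - C (r i))).Separable :=
    separable_prod_X_sub_C_iff'.2 (fun x _ y _ hxy => hr hxy)
  rw [Polynomial.Separable, h, isCoprime_zero_right] at hs
  have h1 := natDegree_eq_zero_of_isUnit hs
  rw [natDegree_prod_of_monic _ _ (fun i _ => monic_X_sub_C _)] at h1
  simp at h1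
  exact hS.ne_empty h1

theorem aux_deg {K : Type*} [Field K] [CharP K 2] (p : K[X]) (m : ℕ)
    (hm : p.natDegree = m + 2) (h2 : Even m) :
    (derivative p).natDegree ≤ m := by
  rw [natDegree_le_iff_coeff_eq_zero]
  intro N hN
  rw [coeff_derivative]
  rcases Nat.lt_or_ge (m + 1) N with h | h
  · rw [coeff_eq_zero_of_natDegree_lt (by omega), zero_mul]
  · have : N = m + 1 := by omega
    subst this
    have : (((m + 1 + 1 : ℕ)) : K) = 0 := by
      rw [CharP.cast_eq_zero_iff K 2]; exact (h2.add (by decide : Even 2)).two_dvd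
    push_cast at this ⊢
    rw [this, mul_zero]

theorem aux_deg3 {K : Type*} [Field K] (p : K[X]) (m : ℕ)
    (hm : p.natDegree = m + 1) :
    (derivative p).natDegree ≤ m := by
  have := natDegree_derivative_le p
  omega

theorem aux_sum {K : Type*} [Field K] [CharP K 2] (r : Fin 8 → K) (S : Finset (Fin 8)) (a : K)
    (ha : ∀ i, r i + a ≠ 0) (h : ∑ i ∈ S, (r i + a)⁻¹ = 0) :
    (derivative (∏ i ∈ S, (X - C (r i)))).eval a = 0 := by
  have e : ∀ i, a - r i = r i + a := fun i => by rw [CharTwo.sub_eq_add, add_comm]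
  rw [derivative_prod_finset, eval_finset_sum]
  simp only [eval_mul, eval_prod, derivative_sub, derivative_X, derivative_C, sub_zero, eval_one,
    mul_one, eval_sub, eval_X, eval_C, e]
  have : ∀ i ∈ S, ∏ j ∈ S.erase i, (r j + a) = (∏ j ∈ S, (r j + a)) * (r i + a)⁻¹ := by
    intro i hi
    rw [← Finset.mul_prod_erase S _ hi]
    field_simp [ha i]
  rw [Finset.sum_congr rfl this, ← Finset.mul_sum, h, mul_zero]

/-- Over a field `k` of characteristic 2 with at least 227 elements, given a monic separable
polynomial `f` of degree 8 splitting over `K` with distinct roots `r 0, …, r 7` and with no root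
in `k`, there is an `α ∈ k` with `rᵢ + α ≠ 0` for all `i` such that for every subset `S` of the
indices of size 3 or 6 the sum of the reciprocals `(rᵢ + α)⁻¹`, `i ∈ S`, is nonzero. -/
theorem stmt_14 {k K : Type*} [Field k] [CharP k 2] [Field K] [Algebra k K]
    (hcard : 227 ≤ Cardinal.mk k)
    (f : Polynomial k) (hmonic : f.Monic) (hsep : f.Separable) (hdeg : f.natDegree = 8)
    (r : Fin 8 → K) (hr : Function.Injective r)
    (hsplit : f.map (algebraMap k K) = ∏ i, (X - C (r i)))
    (hnoroot : ∀ x : k, f.eval x ≠ 0) :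
    ∃ α : k, (∀ i, r i + algebraMap k K α ≠ 0) ∧
      ∀ S : Finset (Fin 8), S.card = 3 ∨ S.card = 6 →
        ∑ i ∈ S, (r i + algebraMap k K α)⁻¹ ≠ 0 := by
  classical
  haveI : CharP K 2 := charP_of_injective_algebraMap (algebraMap k K).injective 2
  have hne : ∀ (α : k) i, r i + algebraMap k K α ≠ 0 := by
    intro α i h
    apply hnoroot α
    apply (algebraMap k K).injective
    rw [map_zero, ← eval_map_apply, hsplit, eval_prod]
    apply Finset.prod_eq_zero (Finset.mem_univ i)
    rw [eval_sub, eval_X, eval_C, CharTwo.sub_eq_add, add_comm, h]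
  let D : Finset (Fin 8) → K[X] := fun S => derivative (∏ i ∈ S, (X - C (r i)))
  have hd : ∀ S : Finset (Fin 8), (∏ i ∈ S, (X - C (r i))).natDegree = S.card := by
    intro S
    rw [natDegree_prod_of_monic _ _ (fun i _ => monic_X_sub_C _)]
    simp
  have hroots : ∀ (S : Finset (Fin 8)) (m : ℕ), (D S).natDegree ≤ m →
      (D S).roots.toFinset.card ≤ m := fun S m h =>
    (Multiset.toFinset_card_le _).trans ((card_roots' _).trans h)
  let B3 := (Finset.powersetCard 3 (Finset.univ : Finset (Fin 8))).biUnion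
    fun S => (D S).roots.toFinset
  let B6 := (Finset.powersetCard 6 (Finset.univ : Finset (Fin 8))).biUnion
    fun S => (D S).roots.toFinset
  have h3 : B3.card ≤ 56 * 2 := by
    refine (Finset.card_biUnion_le_card_mul _ _ 2 ?_).trans (le_of_eq ?_)
    · intro S hS
      have hc := (Finset.mem_powersetCard.1 hS).2
      exact hroots S 2 (aux_deg3 _ 2 (by rw [hd, hc]))
    · rw [Finset.card_powersetCard]; rfl
  have h6 : B6.card ≤ 28 * 4 := by
    refine (Finset.card_biUnion_le_card_mul _ _ 4 ?_).trans (le_of_eq ?_)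
    · intro S hS
      have hc := (Finset.mem_powersetCard.1 hS).2
      exact hroots S 4 (aux_deg _ 4 (by rw [hd, hc]) (by decide))
    · rw [Finset.card_powersetCard]; rfl
  have hB : (B3 ∪ B6).card ≤ 224 := (Finset.card_union_le _ _).trans (by omega)
  have hex : ∃ α : k, algebraMap k K α ∉ B3 ∪ B6 := by
    by_contra hcon
    push Not at hcon
    let g : k → (B3 ∪ B6 : Finset K) := fun α => ⟨_, hcon α⟩
    have hg : Function.Injective g := fun x y h =>
      (algebraMap k K).injective (congrArg Subtype.val h)
    haveI := Finite.of_injective g hg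
    have h1 := Nat.card_le_card_of_injective g hg
    rw [Nat.card_eq_fintype_card (α := (B3 ∪ B6 : Finset K)), Fintype.card_coe] at h1
    rw [← Nat.cast_card (α := k)] at hcard
    have h2 : 227 ≤ Nat.card k := by exact_mod_cast hcard
    omega
  obtain ⟨α, hα⟩ := hex
  refine ⟨α, hne α, fun S hS h0 => hα ?_⟩
  have hev := aux_sum r S _ (hne α) h0
  have hD : D S ≠ 0 := aux_deriv r hr S (Finset.card_pos.1 (by omega))
  have hmem : algebraMap k K α ∈ (D S).roots.toFinset :=
    Multiset.mem_toFinset.2 ((mem_roots hD).2 hev)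
  rcases hS with hS | hS
  · exact Finset.mem_union_left _ (Finset.mem_biUnion.2
      ⟨S, Finset.mem_powersetCard.2 ⟨Finset.subset_univ _, hS⟩, hmem⟩)
  · exact Finset.mem_union_right _ (Finset.mem_biUnion.2
      ⟨S, Finset.mem_powersetCard.2 ⟨Finset.subset_univ _, hS⟩, hmem⟩)
end

section
/- Let k be a field of characteristic 2 and let f ∈ k[t] be a separable polynomial, i.e. f is coprime to its formal derivative f′. Then the affine surface in 𝔸³ over k defined by the equation x² + x·y + t·y² + f(t) = 0 is smooth over k; equivalently, the quotient ring k[t, x, y]/(x² + xy + ty² + f(t)) is a smooth k-algebra. -/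
theorem stmt_16_key {k B : Type*} [Field k] [CharP k 2] [CommRing B] [Algebra k B]
    (f : Polynomial k) (hf : f.Separable) (t x y : B)
    (he : (x ^ 2 + x * y + t * y ^ 2 + Polynomial.aeval t f) ^ 2 = 0) :
    ∃ a b c : B, ∀ e, e = x ^ 2 + x * y + t * y ^ 2 + Polynomial.aeval t f →
      (x + b * e) ^ 2 + (x + b * e) * (y + c * e) + (t + a * e) * (y + c * e) ^ 2 +
        Polynomial.aeval (t + a * e) f = 0 := by
  obtain ⟨u, v, huv⟩ := hf
  have h1 := congrArg (Polynomial.aeval t) huv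
  simp only [map_add, map_mul, map_one] at h1
  have h2 : (2 : B) = 0 := by
    have := congrArg (algebraMap k B) (CharTwo.two_eq_zero (R := k))
    rwa [map_ofNat, map_zero] at this
  set U := Polynomial.aeval t u
  set V := Polynomial.aeval t v
  refine ⟨V, U * (x + t * y) + V * y, U * x, ?_⟩
  intro e hE
  rw [← hE] at he
  rw [Polynomial.aeval_add_of_sq_eq_zero _ _ _ (by rw [mul_pow, he, mul_zero])]
  set G := Polynomial.aeval t f
  set G' := Polynomial.aeval t (Polynomial.derivative f)
  grind

theorem stmt_16 {k : Type*} [Field k] [CharP k 2]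
    (f : Polynomial k) (hf : f.Separable) :
    Algebra.Smooth k (MvPolynomial (Fin 3) k ⧸ Ideal.span
      {MvPolynomial.X 1 ^ 2 + MvPolynomial.X 1 * MvPolynomial.X 2 +
        MvPolynomial.X 0 * MvPolynomial.X 2 ^ 2 +
        Polynomial.aeval (MvPolynomial.X 0 : MvPolynomial (Fin 3) k) f}) := by
  set F : MvPolynomial (Fin 3) k := MvPolynomial.X 1 ^ 2 + MvPolynomial.X 1 * MvPolynomial.X 2 +
        MvPolynomial.X 0 * MvPolynomial.X 2 ^ 2 +
        Polynomial.aeval (MvPolynomial.X 0 : MvPolynomial (Fin 3) k) f with hF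
  have hFP : Algebra.FinitePresentation k (MvPolynomial (Fin 3) k ⧸ Ideal.span {F}) :=
    Algebra.FinitePresentation.quotient ⟨{F}, by simp⟩
  refine ⟨Algebra.FormallySmooth.of_comp_surjective ?_, hFP⟩
  intro B _ _ I hI g
  let q := g.comp (Ideal.Quotient.mkₐ k (Ideal.span {F}))
  have hq : q F = 0 := by
    have : (Ideal.Quotient.mkₐ k (Ideal.span {F})) F = 0 :=
      Ideal.Quotient.eq_zero_iff_mem.mpr (Ideal.mem_span_singleton_self F)
    simp only [q, AlgHom.comp_apply, this, map_zero]
  choose s hs using fun i : Fin 3 => Ideal.Quotient.mkₐ_surjective k I (q (MvPolynomial.X i))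
  obtain ⟨e, he⟩ : ∃ e, e = s 1 ^ 2 + s 1 * s 2 + s 0 * s 2 ^ 2 + Polynomial.aeval (s 0) f :=
    ⟨_, rfl⟩
  have heI : e ∈ I := by
    rw [← Ideal.Quotient.eq_zero_iff_mem, ← Ideal.Quotient.mkₐ_eq_mk k, he]
    simp only [map_add, map_mul, map_pow, ← Polynomial.aeval_algHom_apply, hs]
    rw [← hq, hF]
    simp only [map_add, map_mul, map_pow, ← Polynomial.aeval_algHom_apply]
  have he2 : e ^ 2 = 0 := by
    have := Ideal.pow_mem_pow heI 2
    rwa [hI, Ideal.mem_bot] at this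
  obtain ⟨a, b, c, habc⟩ := stmt_16_key f hf (s 0) (s 1) (s 2) (he ▸ he2)
  have h0 := habc e he
  let φ : MvPolynomial (Fin 3) k →ₐ[k] B :=
    MvPolynomial.aeval ![s 0 + a * e, s 1 + b * e, s 2 + c * e]
  have hφ : φ F = 0 := by
    rw [hF, ← h0]
    simp only [map_add, map_mul, map_pow, ← Polynomial.aeval_algHom_apply]
    simp [φ]
  refine ⟨Ideal.Quotient.liftₐ (Ideal.span {F}) φ ?_, ?_⟩
  · intro z hz
    obtain ⟨w, rfl⟩ := Ideal.mem_span_singleton'.mp hz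
    rw [map_mul, hφ, mul_zero]
  · have he0 : Ideal.Quotient.mkₐ k I e = 0 := Ideal.Quotient.eq_zero_iff_mem.mpr heI
    apply Ideal.Quotient.algHom_ext
    apply MvPolynomial.algHom_ext
    intro i
    change Ideal.Quotient.mkₐ k I (φ (MvPolynomial.X i)) = q (MvPolynomial.X i)
    rw [← hs]
    fin_cases i <;> simp only [φ, MvPolynomial.aeval_X] <;>
      simp [-Ideal.Quotient.mkₐ_eq_mk, he0]
end
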